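/- arXiv:1007.3921 — 2 statements merged into one kernel-verified Lean document; each statement's English description precedes it below -/
import Mathlib

section
/- Let N ≥ 2, let f satisfy (H1), and let u be any bounded nonnegative solution of problem (eq) in the quarter-space Ω with boundary datum u₀ ≢ 0. Then liminf_{R→+∞} inf_{(R,+∞)×ℝ^{N-2}×(R,+∞)} u ≥ μ; that is, for every δ > 0 there exists R > 0 such that u(x) ≥ μ − δ for all x = (x₁,x',x_N) with x₁ > R and x_N > R. -/
open Set Filter

noncomputable section

/-- Partial derivative of `u` in the `i`-th coordinate direction. -/
def pd {N : ℕ} (i : Fin N) (u : (Fin N → ℝ) → ℝ) (x : Fin N → ℝ) : ℝ :=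
  deriv (fun t => u (Function.update x i t)) (x i)

/-- Laplace operator: the sum of the pure second partial derivatives. -/
def lap {N : ℕ} (u : (Fin N → ℝ) → ℝ) (x : Fin N → ℝ) : ℝ :=
  ∑ i, pd i (pd i u) x

/-- `f` is locally Lipschitz-continuous on `[0, +∞)`. -/
def LocLipOn (f : ℝ → ℝ) : Prop :=
  ∀ b : ℝ, ∃ L : NNReal, LipschitzOnWith L f (Set.Icc 0 b)

/-- Hypothesis (H1): `f` is locally Lipschitz on `[0,∞)`, positive on `(0,μ)`, nonpositive on
`[μ,∞)`, nonincreasing on `[μ',μ]`, and either `f(0) > 0` or `f(0) = 0` with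
`liminf_{s→0⁺} f(s)/s > 0`. -/
def H1 (f : ℝ → ℝ) (μ' μ : ℝ) : Prop :=
  LocLipOn f ∧ 0 < μ' ∧ μ' < μ ∧
  (∀ s, 0 < s → s < μ → 0 < f s) ∧
  (∀ s, μ ≤ s → f s ≤ 0) ∧
  (∀ s t, μ' ≤ s → s ≤ t → t ≤ μ → f t ≤ f s) ∧
  (0 < f 0 ∨ (f 0 = 0 ∧ ∃ c > 0, ∀ᶠ s in nhdsWithin (0:ℝ) (Set.Ioi 0), c ≤ f s / s))

/-- Hypothesis (H2): `f` is locally Lipschitz and nonnegative on `[0,∞)`, and at every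
nonnegative zero `z` of `f`, `liminf_{s→z⁺} f(s)/(s-z) > 0`. -/
def H2 (f : ℝ → ℝ) : Prop :=
  LocLipOn f ∧ (∀ s, 0 ≤ s → 0 ≤ f s) ∧
  (∀ z, 0 ≤ z → f z = 0 → ∃ c > 0, ∀ᶠ s in nhdsWithin z (Set.Ioi z), c ≤ f s / (s - z))

/-- Hypothesis (H3): `liminf_{s→z⁻} f(s)/(s-z) > 0` for every zero `z > μ` of `f`. -/
def H3 (f : ℝ → ℝ) (μ : ℝ) : Prop :=
  ∀ z, μ < z → f z = 0 → ∃ c > 0, ∀ᶠ s in nhdsWithin z (Set.Iio z), c ≤ f s / (s - z)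

/-- `(V, V')` is a `C²` solution on `[0,+∞)` of `V'' + f(V) = 0` with `V(0) = 0`,
`0 < V < z` on `(0,+∞)` and `V(+∞) = z` (the one-dimensional profile `V_z`). -/
def IsProfile (f : ℝ → ℝ) (z : ℝ) (V V' : ℝ → ℝ) : Prop :=
  (∀ ξ ∈ Set.Ici (0:ℝ), HasDerivWithinAt V (V' ξ) (Set.Ici 0) ξ) ∧
  (∀ ξ ∈ Set.Ici (0:ℝ), HasDerivWithinAt V' (-(f (V ξ))) (Set.Ici 0) ξ) ∧
  V 0 = 0 ∧ (∀ ξ, 0 < ξ → 0 < V ξ ∧ V ξ < z) ∧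
  Filter.Tendsto V Filter.atTop (nhds z)

/-- The translates `x ↦ u(x + h e₁)` converge as `h → +∞`, uniformly on `K` together with all
partial derivatives up to order two, to the limits `w`, `w1 i`, `w2 i j`. -/
def C2ConvOn {N : ℕ} (i0 : Fin N) (u : (Fin N → ℝ) → ℝ) (K : Set (Fin N → ℝ))
    (w : (Fin N → ℝ) → ℝ) (w1 : Fin N → (Fin N → ℝ) → ℝ)
    (w2 : Fin N → Fin N → (Fin N → ℝ) → ℝ) : Prop :=
  TendstoUniformlyOn (fun (h : ℝ) x => u (Function.update x i0 (x i0 + h))) w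
    Filter.atTop K ∧
  (∀ i, TendstoUniformlyOn (fun (h : ℝ) x => pd i u (Function.update x i0 (x i0 + h)))
      (w1 i) Filter.atTop K) ∧
  (∀ i j, TendstoUniformlyOn
      (fun (h : ℝ) x => pd i (pd j u) (Function.update x i0 (x i0 + h)))
      (w2 i j) Filter.atTop K)

/-- `F(z) = ∫₀^z f(σ) dσ`. -/
def Ff (f : ℝ → ℝ) (z : ℝ) : ℝ := ∫ σ in (0:ℝ)..z, f σ

/-- The set `Z_f = {z₀ ≥ 0 : f(z₀) = 0 and F(z) < F(z₀) for all z ∈ [0,z₀)}`. -/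
def Zf (f : ℝ → ℝ) : Set ℝ :=
  {z | 0 ≤ z ∧ f z = 0 ∧ ∀ w, 0 ≤ w → w < z → Ff f w < Ff f z}

/-- `(V, V')` belongs to `R_f`: a bounded nonnegative `C²` solution on `[0,∞)` of
`V'' + f(V) = 0` with `V(0) = 0`. -/
def InRf (f V V' : ℝ → ℝ) : Prop :=
  (∀ ξ ∈ Set.Ici (0:ℝ), HasDerivWithinAt V (V' ξ) (Set.Ici 0) ξ) ∧
  (∀ ξ ∈ Set.Ici (0:ℝ), HasDerivWithinAt V' (-(f (V ξ))) (Set.Ici 0) ξ) ∧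
  V 0 = 0 ∧ (∀ ξ, 0 ≤ ξ → 0 ≤ V ξ) ∧ (∃ C, ∀ ξ, 0 ≤ ξ → V ξ ≤ C)

/-- The squared Euclidean distance on `Fin N → ℝ`. -/
def sqDist {N : ℕ} (y x : Fin N → ℝ) : ℝ := ∑ i, (x i - y i) ^ 2

lemma continuous_sqDist {N : ℕ} (y : Fin N → ℝ) : Continuous (sqDist y) := by
  unfold sqDist; fun_prop

lemma sqDist_self {N : ℕ} (y : Fin N → ℝ) : sqDist y y = 0 := by simp [sqDist]

lemma sqDist_nonneg {N : ℕ} (y x : Fin N → ℝ) : 0 ≤ sqDist y x :=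
  Finset.sum_nonneg fun _ _ => sq_nonneg _

lemma abs_sub_le_of_sqDist_le {N : ℕ} {y x : Fin N → ℝ} {ρ : ℝ} (hρ : 0 ≤ ρ)
    (h : sqDist y x ≤ ρ ^ 2) (i : Fin N) : |x i - y i| ≤ ρ := by
  refine abs_le_of_sq_le_sq ?_ hρ
  exact (Finset.single_le_sum (f := fun i => (x i - y i) ^ 2)
    (fun _ _ => sq_nonneg _) (Finset.mem_univ i)).trans h

lemma isCompact_sqDist_le {N : ℕ} (y : Fin N → ℝ) {ρ : ℝ} (hρ : 0 ≤ ρ) :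
    IsCompact {x | sqDist y x ≤ ρ ^ 2} := by
  refine (isCompact_closedBall y ρ).of_isClosed_subset
    (isClosed_le (continuous_sqDist y) continuous_const) fun x hx => ?_
  rw [Metric.mem_closedBall, dist_pi_le_iff hρ]
  exact fun i => abs_sub_le_of_sqDist_le hρ hx i

lemma sqDist_update {N : ℕ} (y x : Fin N → ℝ) (i : Fin N) (t : ℝ) :
    sqDist y (Function.update x i t) = sqDist y x - (x i - y i) ^ 2 + (t - y i) ^ 2 := by
  unfold sqDist
  rw [← Finset.add_sum_erase _ _ (Finset.mem_univ i),
    ← Finset.add_sum_erase _ (fun j => (x j - y j) ^ 2) (Finset.mem_univ i)]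
  have : ∑ j ∈ Finset.univ.erase i, (Function.update x i t j - y j) ^ 2
      = ∑ j ∈ Finset.univ.erase i, (x j - y j) ^ 2 :=
    Finset.sum_congr rfl fun j hj => by
      rw [Function.update_of_ne (Finset.ne_of_mem_erase hj)]
  rw [this, Function.update_self]
  ring

lemma pd_pd_eq {N : ℕ} (i : Fin N) (u : (Fin N → ℝ) → ℝ) (x : Fin N → ℝ) :
    pd i (pd i u) x = deriv (deriv fun t => u (Function.update x i t)) (x i) := by
  unfold pd
  congr 1
  ext t
  simp

/-- A function has nonnegative second derivative at a local minimum. -/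
lemma deriv_deriv_nonneg_of_isLocalMin {w : ℝ → ℝ} {a : ℝ} (h : IsLocalMin w a)
    (hc : ContinuousAt w a) : 0 ≤ deriv (deriv w) a := by
  by_contra! hneg
  have hmax := isLocalMax_of_deriv_deriv_neg hneg h.deriv_eq_zero hc
  have hconst : w =ᶠ[nhds a] fun _ => w a := by
    filter_upwards [h, hmax] with t h1 h2 using le_antisymm h2 h1
  have h2 : deriv (deriv w) a = 0 := by
    rw [hconst.deriv.deriv_eq]
    simp
  exact hneg.ne h2

/-- If a radial function `g (|x - y|²)` touches `u` from below at `x` (up to a constant), its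
Laplacian there is at most that of `u`. -/
lemma radial_lap_le_of_isLocalMin {N : ℕ} {u : (Fin N → ℝ) → ℝ} {x y : Fin N → ℝ}
    {g g' g'' : ℝ → ℝ} (hu : ContDiffAt ℝ 2 u x)
    (hg : ∀ s, HasDerivAt g (g' s) s) (hg' : ∀ s, HasDerivAt g' (g'' s) s)
    (hmin : IsLocalMin (fun z => u z - g (sqDist y z)) x) :
    4 * sqDist y x * g'' (sqDist y x) + 2 * N * g' (sqDist y x) ≤ lap u x := by
  have key : ∀ i, 4 * (x i - y i) ^ 2 * g'' (sqDist y x) + 2 * g' (sqDist y x)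
      ≤ pd i (pd i u) x := by
    intro i
    rw [pd_pd_eq]
    set a : ℝ → ℝ := fun t => u (Function.update x i t) with ha_def
    have hupd : ContDiff ℝ 2 (fun t : ℝ => Function.update x i t) :=
      contDiff_update 2 x i
    have hux : ContDiffAt ℝ 2 u (Function.update x i (x i)) := by
      rwa [Function.update_eq_self]
    have ha : ContDiffAt ℝ 2 a (x i) := hux.comp (x i) hupd.contDiffAt
    set Q : ℝ → ℝ := fun t => sqDist y x - (x i - y i) ^ 2 + (t - y i) ^ 2 with hQ_def
    have hQx : Q (x i) = sqDist y x := by simp [hQ_def]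
    have hQ : ∀ t, HasDerivAt Q (2 * (t - y i)) t := by
      intro t
      have := (((hasDerivAt_id' t).sub_const (y i)).fun_pow 2).const_add
        (sqDist y x - (x i - y i) ^ 2)
      simpa [hQ_def] using this
    have hb : ∀ t, HasDerivAt (fun t => g (Q t)) (g' (Q t) * (2 * (t - y i))) t :=
      fun t => (hg (Q t)).comp t (hQ t)
    have hb' : HasDerivAt (fun t => g' (Q t) * (2 * (t - y i)))
        (4 * (x i - y i) ^ 2 * g'' (sqDist y x) + 2 * g' (sqDist y x)) (x i) := by
      have h1 : HasDerivAt (fun t => g' (Q t)) (g'' (Q (x i)) * (2 * (x i - y i))) (x i) :=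
        (hg' (Q (x i))).comp (x i) (hQ (x i))
      have h2 : HasDerivAt (fun t : ℝ => 2 * (t - y i)) 2 (x i) := by
        simpa using ((hasDerivAt_id (x i)).sub_const (y i)).const_mul 2
      refine (h1.fun_mul h2).congr_deriv ?_
      rw [hQx]; ring
    have hline : IsLocalMin (fun t => a t - g (Q t)) (x i) := by
      have hc : ContinuousAt (fun t : ℝ => Function.update x i t) (x i) :=
        hupd.continuous.continuousAt
      have hm : IsLocalMin (fun z => u z - g (sqDist y z)) (Function.update x i (x i)) := by
        rwa [Function.update_eq_self]
      have := IsMinFilter.comp_tendsto hm hc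
      simp only [Function.comp_def, sqDist_update] at this
      exact this
    have hda : ∀ᶠ t in nhds (x i), DifferentiableAt ℝ a t := by
      have := (ha.of_le (m := 1) (by norm_num)).eventually (by simp)
      exact this.mono fun t ht => ht.differentiableAt (by simp)
    have hderiv : deriv (fun t => a t - g (Q t)) =ᶠ[nhds (x i)]
        fun t => deriv a t - g' (Q t) * (2 * (t - y i)) := by
      filter_upwards [hda] with t ht
      exact (ht.hasDerivAt.sub (hb t)).deriv
    have hdda : DifferentiableAt ℝ (deriv a) (x i) :=
      ((ha.fderiv_right (m := 1) (by norm_num)).differentiableAt (by simp)).clm_apply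
        (differentiableAt_const 1)
    have hfin := deriv_deriv_nonneg_of_isLocalMin hline
      (ha.continuousAt.sub (hb _).continuousAt)
    rw [hderiv.deriv_eq, (hdda.hasDerivAt.fun_sub hb').deriv] at hfin
    linarith
  calc 4 * sqDist y x * g'' (sqDist y x) + 2 * N * g' (sqDist y x)
      = ∑ i, (4 * (x i - y i) ^ 2 * g'' (sqDist y x) + 2 * g' (sqDist y x)) := by
        rw [Finset.sum_add_distrib, ← Finset.sum_mul, ← Finset.mul_sum]
        simp [sqDist]
        ring
    _ ≤ lap u x := Finset.sum_le_sum fun i _ => key i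

/-- `radial_lap_le_of_isLocalMin` at a minimum over a closed ball attained in its interior. -/
lemma radial_lap_le_of_isMinOn {N : ℕ} {u : (Fin N → ℝ) → ℝ} {x y : Fin N → ℝ} {ρ : ℝ}
    {g g' g'' : ℝ → ℝ} (hu : ContDiffAt ℝ 2 u x)
    (hg : ∀ s, HasDerivAt g (g' s) s) (hg' : ∀ s, HasDerivAt g' (g'' s) s)
    (hx : sqDist y x < ρ ^ 2)
    (hmin : ∀ z, sqDist y z ≤ ρ ^ 2 → u x - g (sqDist y x) ≤ u z - g (sqDist y z)) :
    4 * sqDist y x * g'' (sqDist y x) + 2 * N * g' (sqDist y x) ≤ lap u x := by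
  refine radial_lap_le_of_isLocalMin hu hg hg' ?_
  filter_upwards [(isOpen_lt (continuous_sqDist y) continuous_const).mem_nhds hx] with z hz
  exact hmin z (le_of_lt hz)

lemma hasDerivAt_const_mul_sub_pow (η T : ℝ) (k : ℕ) (s : ℝ) :
    HasDerivAt (fun s => η * (T - s) ^ (k + 1)) (-η * (k + 1) * (T - s) ^ k) s := by
  refine ((((hasDerivAt_id' s).const_sub T).fun_pow (k + 1)).const_mul η).congr_deriv ?_
  push_cast
  ring

/-- Propagation of positivity for supersolutions of `Δu ≤ L u` from a ball to a larger
concentric ball. -/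
lemma pos_of_pos_on_smaller_ball {N : ℕ} {Ω : Set (Fin N → ℝ)} (hΩ : IsOpen Ω)
    {u : (Fin N → ℝ) → ℝ} (hu : ContDiffOn ℝ 2 u Ω) (hu0 : ∀ x ∈ Ω, 0 ≤ u x)
    {L : ℝ} (hL : 0 ≤ L) (hlap : ∀ x ∈ Ω, lap u x ≤ L * u x)
    {y : Fin N → ℝ} {r ρ : ℝ} (hr : 0 < r) (hrρ : r < ρ)
    (hball : ∀ x, sqDist y x ≤ ρ ^ 2 → x ∈ Ω)
    (hpos : ∀ x, sqDist y x ≤ r ^ 2 → 0 < u x) :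
    ∀ x, sqDist y x < ρ ^ 2 → 0 < u x := by
  have hρ : 0 < ρ := hr.trans hrρ
  have hrr : r ^ 2 < ρ ^ 2 := by gcongr
  have hcont : ContinuousOn u {x | sqDist y x ≤ ρ ^ 2} := hu.continuousOn.mono hball
  obtain ⟨xm, hxm, hxmin⟩ := (isCompact_sqDist_le y hr.le).exists_isMinOn
    ⟨y, by simp only [mem_ofPred_eq, sqDist_self]; positivity⟩
    (hcont.mono fun x (hx : _ ≤ _) => hx.trans hrr.le)
  obtain ⟨k, hk⟩ := exists_nat_gt ((2 * N * ρ ^ 2 + L * (ρ ^ 2) ^ 2) / (4 * r ^ 2))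
  rw [div_lt_iff₀ (by positivity)] at hk
  set η : ℝ := u xm / (ρ ^ 2) ^ (k + 2) with hη_def
  have hη : 0 < η := div_pos (hpos _ hxm) (by positivity)
  set g : ℝ → ℝ := fun s => η * (ρ ^ 2 - s) ^ (k + 2) with hg_def
  have hg : ∀ s, HasDerivAt g (-η * (k + 2) * (ρ ^ 2 - s) ^ (k + 1)) s := by
    intro s
    convert hasDerivAt_const_mul_sub_pow η (ρ ^ 2) (k + 1) s using 1
    push_cast; ring
  have hg' : ∀ s, HasDerivAt (fun s => -η * (k + 2) * (ρ ^ 2 - s) ^ (k + 1))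
      (η * (k + 2) * (k + 1) * (ρ ^ 2 - s) ^ k) s := by
    intro s
    convert hasDerivAt_const_mul_sub_pow (-η * (k + 2)) (ρ ^ 2) k s using 1
    ring
  obtain ⟨x₀, hx₀, hmin⟩ := (isCompact_sqDist_le y hρ.le).exists_isMinOn
    ⟨y, by simp only [mem_ofPred_eq, sqDist_self]; positivity⟩
    (hcont.sub (f := u) (g := fun z => g (sqDist y z))
      (by have := continuous_sqDist y; fun_prop))
  have hx₀' : sqDist y x₀ ≤ ρ ^ 2 := hx₀
  have hw : 0 ≤ u x₀ - g (sqDist y x₀) := by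
    by_contra! hneg
    have hin : r ^ 2 < sqDist y x₀ := by
      by_contra! hle
      have h1 : u xm ≤ u x₀ := hxmin hle
      have h2 : g (sqDist y x₀) ≤ u xm := by
        have : (ρ ^ 2 - sqDist y x₀) ^ (k + 2) ≤ (ρ ^ 2) ^ (k + 2) := by
          have := sqDist_nonneg y x₀
          gcongr
          linarith
        calc g (sqDist y x₀) ≤ η * (ρ ^ 2) ^ (k + 2) := by simp only [hg_def]; gcongr
          _ = u xm := by rw [hη_def]; field_simp
      linarith
    have hout : sqDist y x₀ < ρ ^ 2 := by
      refine lt_of_le_of_ne hx₀' fun heq => ?_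
      have := hu0 x₀ (hball x₀ hx₀')
      simp [hg_def, heq] at hneg
      linarith
    have hmem := hball x₀ hx₀'
    have h1 := radial_lap_le_of_isMinOn (hu.contDiffAt (hΩ.mem_nhds hmem)) hg hg' hout
      fun z hz => hmin hz
    have h2 := hlap x₀ hmem
    have h3 : L * u x₀ ≤ L * g (sqDist y x₀) := mul_le_mul_of_nonneg_left (by linarith) hL
    set s := sqDist y x₀
    have ht : 0 < ρ ^ 2 - s := by linarith
    have htρ : ρ ^ 2 - s ≤ ρ ^ 2 := by linarith [sq_nonneg r]
    set t := ρ ^ 2 - s with ht_def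
    have hfac : η * t ^ k * (4 * s * ((k + 2) * (k + 1)) - 2 * N * (k + 2) * t - L * t ^ 2)
        ≤ 0 := by
      have : g s = η * t ^ (k + 2) := rfl
      rw [this] at h3
      ring_nf at h1 h3 ⊢
      linarith
    have hbr : 0 < 4 * s * ((k + 2) * (k + 1)) - 2 * N * (k + 2) * t - L * t ^ 2 := by
      have e1 : 2 * N * (k + 2) * t ≤ (k + 2) * (2 * N * ρ ^ 2) := by
        have : (0:ℝ) ≤ 2 * N * (k + 2) := by positivity
        nlinarith
      have e2 : L * t ^ 2 ≤ (k + 2) * (L * (ρ ^ 2) ^ 2) := by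
        have h4 : L * t ^ 2 ≤ L * (ρ ^ 2) ^ 2 := by gcongr
        have h5 : 0 ≤ L * (ρ ^ 2) ^ 2 := by positivity
        have h6 : (0:ℝ) ≤ k := k.cast_nonneg
        nlinarith
      have e3 : (k + 2) * (k * (4 * r ^ 2)) ≤ 4 * s * ((k + 2) * (k + 1)) := by
        have h6 : (0:ℝ) ≤ k := k.cast_nonneg
        calc ((k:ℝ) + 2) * (k * (4 * r ^ 2)) ≤ (k + 2) * ((k + 1) * (4 * s)) := by
              gcongr
              linarith
          _ = _ := by ring
      have e4 := mul_lt_mul_of_pos_left hk (by positivity : (0:ℝ) < k + 2)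
      linarith
    have : 0 < η * t ^ k := by positivity
    nlinarith [mul_pos this hbr]
  intro x hx
  have h1 : u x₀ - g (sqDist y x₀) ≤ u x - g (sqDist y x) := hmin hx.le
  have h2 : 0 < g (sqDist y x) := by
    have : 0 < ρ ^ 2 - sqDist y x := by linarith
    simp only [hg_def]; positivity
  linarith

/-- Strong maximum principle: a nonnegative supersolution of `Δu ≤ L u` on a connected open set
which is positive somewhere is positive everywhere. -/
lemma pos_of_exists_pos {N : ℕ} {Ω : Set (Fin N → ℝ)} (hΩ : IsOpen Ω) (hconn : IsPreconnected Ω)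
    {u : (Fin N → ℝ) → ℝ} (hu : ContDiffOn ℝ 2 u Ω) (hu0 : ∀ x ∈ Ω, 0 ≤ u x)
    {L : ℝ} (hL : 0 ≤ L) (hlap : ∀ x ∈ Ω, lap u x ≤ L * u x)
    (hne : ∃ x ∈ Ω, 0 < u x) : ∀ x ∈ Ω, 0 < u x := by
  have hopen : IsOpen (Ω ∩ u ⁻¹' Ioi 0) := hu.continuousOn.isOpen_inter_preimage hΩ isOpen_Ioi
  have hball : ∀ V : Set (Fin N → ℝ), IsOpen V → ∀ z ∈ V,
      ∃ ε > 0, ∀ x, (∀ i, |x i - z i| ≤ ε) → x ∈ V := by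
    intro V hV z hz
    obtain ⟨ε, hε, h⟩ := Metric.nhds_basis_closedBall.mem_iff.1 (hV.mem_nhds hz)
    refine ⟨ε, hε, fun x hx => h ?_⟩
    rw [Metric.mem_closedBall, dist_pi_le_iff hε.le]
    exact hx
  have hsub : Ω ⊆ Ω ∩ u ⁻¹' Ioi 0 := by
    refine hconn.subset_of_closure_inter_subset hopen ?_ ?_
    · obtain ⟨x, hx, hxu⟩ := hne
      exact ⟨x, hx, hx, hxu⟩
    · rintro z ⟨hzc, hz⟩
      refine ⟨hz, ?_⟩
      obtain ⟨ε, hε, hεΩ⟩ := hball Ω hΩ z hz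
      have hρ : 0 < ε / 2 := by positivity
      have hnear : {y | sqDist y z < (ε / 2) ^ 2 ∧ ∀ i, |y i - z i| < ε / 2} ∈ nhds z := by
        have hc : Continuous fun y => sqDist y z := by unfold sqDist; fun_prop
        have h1 : ∀ᶠ y in nhds z, sqDist y z < (ε / 2) ^ 2 :=
          hc.continuousAt.eventually_lt_const (by simp only [sqDist_self]; positivity)
        have h2 : ∀ᶠ y in nhds z, ∀ i, |y i - z i| < ε / 2 := by
          filter_upwards [Metric.ball_mem_nhds z hρ] with y hy
          exact (dist_pi_lt_iff hρ).1 hy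
        exact h1.and h2
      obtain ⟨y, hy, hyΩ, hyu⟩ := mem_closure_iff_nhds.1 hzc _ hnear
      obtain ⟨r, hr, hrV⟩ := hball _ hopen y ⟨hyΩ, hyu⟩
      have hr' : 0 < min r (ε / 4) := by positivity
      refine pos_of_pos_on_smaller_ball hΩ hu hu0 hL hlap hr' (ρ := ε / 2) ?_ ?_ ?_ z hy.1
      · exact (min_le_right _ _).trans_lt (by linarith)
      · intro x hx
        refine hεΩ x fun i => ?_
        have h1 := abs_sub_le_of_sqDist_le hρ.le hx i
        have h2 := hy.2 i
        linarith [abs_sub_le (x i) (y i) (z i)]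
      · intro x hx
        exact (hrV x fun i => (abs_sub_le_of_sqDist_le hr'.le hx i).trans (min_le_left _ _)).2
  exact fun x hx => (hsub hx).2

/-- A positive solution of `Δu + f(u) = 0` on a large ball, where `f(s) ≥ c s` on `(0, s₀]`, is at
least `s₀` at the centre. -/
lemma le_apply_center_of_linear_growth {N : ℕ} {f : ℝ → ℝ} {c s₀ : ℝ}
    (hfc : ∀ s, 0 < s → s ≤ s₀ → c * s ≤ f s)
    {Ω : Set (Fin N → ℝ)} (hΩ : IsOpen Ω) {u : (Fin N → ℝ) → ℝ} (hu : ContDiffOn ℝ 2 u Ω)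
    (hpos : ∀ x ∈ Ω, 0 < u x) (hpde : ∀ x ∈ Ω, lap u x + f (u x) = 0)
    {y : Fin N → ℝ} {R : ℝ} (hR : 0 < R) (hRc : (8 + 4 * (N : ℝ)) ^ 2 < 32 * c * R ^ 2)
    (hball : ∀ x, sqDist y x ≤ R ^ 2 → x ∈ Ω) : s₀ ≤ u y := by
  have hyb : sqDist y y ≤ R ^ 2 := by rw [sqDist_self]; positivity
  have hcont : ContinuousOn u {x | sqDist y x ≤ R ^ 2} := hu.continuousOn.mono hball
  set φ : (Fin N → ℝ) → ℝ := fun x => (R ^ 2 - sqDist y x) ^ 2 with hφ_def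
  have hφc : Continuous φ := by have := continuous_sqDist y; fun_prop
  obtain ⟨x₀, hx₀, hmax⟩ := (isCompact_sqDist_le y hR.le).exists_isMaxOn ⟨y, hyb⟩
    (hφc.continuousOn.div hcont fun x hx => (hpos x (hball x hx)).ne')
  have hx₀' : sqDist y x₀ ≤ R ^ 2 := hx₀
  have hmem := hball x₀ hx₀'
  have hux := hpos x₀ hmem
  have huy := hpos y (hball y hyb)
  by_contra! hlt
  have hφy : φ y = (R ^ 2) ^ 2 := by simp [hφ_def, sqDist_self]
  have h1 : φ y / u y ≤ φ x₀ / u x₀ := hmax hyb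
  have hφx : 0 < φ x₀ := by
    have : 0 < φ y / u y := by rw [hφy]; positivity
    exact (div_pos_iff_of_pos_right hux).1 (this.trans_le h1)
  have hφle : φ x₀ ≤ φ y := by
    rw [hφy]
    have := sqDist_nonneg y x₀
    simp only [hφ_def]
    gcongr
    linarith
  have hout : sqDist y x₀ < R ^ 2 := by
    refine lt_of_le_of_ne hx₀' fun heq => ?_
    simp [hφ_def, heq] at hφx
  set κ : ℝ := u x₀ / φ x₀ with hκ_def
  have hκ : 0 < κ := by positivity
  have hκx : κ * φ x₀ = u x₀ := by rw [hκ_def]; field_simp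
  have hux_le : u x₀ ≤ s₀ := by
    rw [div_le_div_iff₀ huy hux] at h1
    have : u x₀ * φ y ≤ u y * φ y := by nlinarith
    have hφy' : 0 < φ y := hφx.trans_le hφle
    exact (le_of_mul_le_mul_right this hφy').trans hlt.le
  have hg : ∀ s, HasDerivAt (fun s => κ * (R ^ 2 - s) ^ 2) (-(2 * κ) * (R ^ 2 - s)) s := by
    intro s
    convert hasDerivAt_const_mul_sub_pow κ (R ^ 2) 1 s using 1
    push_cast; ring
  have hg' : ∀ s, HasDerivAt (fun s => -(2 * κ) * (R ^ 2 - s)) (2 * κ) s := by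
    intro s
    have := hasDerivAt_const_mul_sub_pow (-(2 * κ)) (R ^ 2) 0 s
    simpa using this
  have h2 := radial_lap_le_of_isMinOn (hu.contDiffAt (hΩ.mem_nhds hmem)) hg hg' hout
    fun z hz => by
      have hz1 : φ z / u z ≤ φ x₀ / u x₀ := hmax hz
      have huz := hpos z (hball z hz)
      have hz2 : κ * φ z ≤ u z := by
        rw [div_le_div_iff₀ huz hux] at hz1
        rw [hκ_def, div_mul_eq_mul_div, div_le_iff₀ hφx]
        linarith
      have e1 : κ * (R ^ 2 - sqDist y x₀) ^ 2 = u x₀ := hκx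
      have e2 : κ * (R ^ 2 - sqDist y z) ^ 2 ≤ u z := hz2
      linarith
  have h3 := hpde x₀ hmem
  have h4 := hfc _ hux hux_le
  have e1 : u x₀ = κ * (R ^ 2 - sqDist y x₀) ^ 2 := hκx.symm
  rw [e1] at h3 h4
  set t := R ^ 2 - sqDist y x₀ with ht
  have e2 : sqDist y x₀ = R ^ 2 - t := by rw [ht]; ring
  rw [e2] at h2
  have hfac : κ * (8 * R ^ 2 - (8 + 4 * N) * t + c * t ^ 2) ≤ 0 := by linarith
  have hbr : 8 * R ^ 2 - (8 + 4 * N) * t + c * t ^ 2 ≤ 0 := by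
    by_contra! h
    linarith [mul_pos hκ h]
  have hc : 0 < c := by
    by_contra! h
    nlinarith [mul_nonneg (neg_nonneg.2 h) (sq_nonneg R), sq_nonneg (8 + 4 * (N : ℝ))]
  nlinarith [sq_nonneg (2 * c * t - (8 + 4 * N)), mul_nonneg hc.le (neg_nonneg.2 hbr)]

/-- A solution of `Δu + f(u) = 0` on a large ball, which is at least `s₀` there, where `f ≥ c₁ > 0`
on `[s₀, m]`, is at least `m` at the centre. -/
lemma le_apply_center_of_lower_bound {N : ℕ} {f : ℝ → ℝ} {c₁ s₀ m : ℝ} (hs₀ : 0 < s₀)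
    (hfc : ∀ s, s₀ ≤ s → s ≤ m → c₁ ≤ f s)
    {Ω : Set (Fin N → ℝ)} (hΩ : IsOpen Ω) {u : (Fin N → ℝ) → ℝ} (hu : ContDiffOn ℝ 2 u Ω)
    (hlow : ∀ x ∈ Ω, s₀ ≤ u x) (hpde : ∀ x ∈ Ω, lap u x + f (u x) = 0) (hm : 0 ≤ m)
    {y : Fin N → ℝ} {ρ : ℝ} (hρ : 0 < ρ) (hρc : 2 * N * m < c₁ * ρ ^ 2)
    (hball : ∀ x, sqDist y x ≤ ρ ^ 2 → x ∈ Ω) : m ≤ u y := by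
  have hyb : sqDist y y ≤ ρ ^ 2 := by rw [sqDist_self]; positivity
  have hcont : ContinuousOn u {x | sqDist y x ≤ ρ ^ 2} := hu.continuousOn.mono hball
  set g : ℝ → ℝ := fun s => m / ρ ^ 2 * (ρ ^ 2 - s) with hg_def
  have hg : ∀ s, HasDerivAt g (-(m / ρ ^ 2)) s := by
    intro s
    have := hasDerivAt_const_mul_sub_pow (m / ρ ^ 2) (ρ ^ 2) 0 s
    simpa using this
  obtain ⟨x₀, hx₀, hmin⟩ := (isCompact_sqDist_le y hρ.le).exists_isMinOn ⟨y, hyb⟩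
    (hcont.sub (f := u) (g := fun z => g (sqDist y z))
      (by have := continuous_sqDist y; fun_prop))
  have hx₀' : sqDist y x₀ ≤ ρ ^ 2 := hx₀
  have hmem := hball x₀ hx₀'
  have hy : u x₀ - g (sqDist y x₀) ≤ u y - g (sqDist y y) := hmin hyb
  have hgy : g (sqDist y y) = m := by simp only [hg_def, sqDist_self]; field_simp; ring
  have hgx : g (sqDist y x₀) ≤ m := by
    rw [← hgy]
    simp only [hg_def, sqDist_self]
    have := sqDist_nonneg y x₀
    gcongr
  by_contra! hlt
  have hout : sqDist y x₀ < ρ ^ 2 := by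
    refine lt_of_le_of_ne hx₀' fun heq => ?_
    have := hlow x₀ hmem
    simp only [hg_def, heq, sub_self, mul_zero] at hy
    have : u x₀ ≤ u y - g (sqDist y y) := by simpa [hg_def] using hy
    linarith
  have h1 := radial_lap_le_of_isMinOn (hu.contDiffAt (hΩ.mem_nhds hmem)) hg
    (fun s => hasDerivAt_const s _) hout fun z hz => hmin hz
  have h2 := hpde x₀ hmem
  have h3 := hfc (u x₀) (hlow x₀ hmem) (by linarith)
  have h4 : c₁ ≤ 2 * N * m / ρ ^ 2 := by
    have : 2 * (N : ℝ) * m / ρ ^ 2 = 2 * N * (m / ρ ^ 2) := by ring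
    rw [this]; linarith
  rw [le_div_iff₀ (by positivity)] at h4
  linarith

/-- Under `(H1)`, `f` grows at least linearly near `0`. -/
lemma H1.exists_linear_growth {f : ℝ → ℝ} {μ' μ : ℝ} (hf : H1 f μ' μ) :
    ∃ c > 0, ∃ s₀ > 0, s₀ < μ ∧ ∀ s, 0 < s → s ≤ s₀ → c * s ≤ f s := by
  obtain ⟨hlip, hμ', hμ, -, -, -, h0⟩ := hf
  have hev : ∃ c > 0, ∀ᶠ s in nhdsWithin (0:ℝ) (Ioi 0), c * s ≤ f s := by
    rcases h0 with h0 | ⟨-, c, hc, h⟩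
    · obtain ⟨L, hL⟩ := hlip 1
      have hcw : ContinuousWithinAt f (Ioi 0) 0 :=
        (hL.continuousOn 0 (by simp)).mono_of_mem_nhdsWithin
          (mem_of_superset (Ioc_mem_nhdsGT one_pos) Ioc_subset_Icc_self)
      refine ⟨f 0, h0, ?_⟩
      have h2 : ContinuousWithinAt (fun s => f s - f 0 * s) (Ioi 0) 0 :=
        hcw.sub (by fun_prop)
      have h3 : ∀ᶠ s in nhdsWithin (0:ℝ) (Ioi 0), 0 < f s - f 0 * s :=
        h2.eventually_const_lt (by simpa using h0)
      exact h3.mono fun s hs => by linarith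
    · refine ⟨c, hc, ?_⟩
      filter_upwards [h, self_mem_nhdsWithin] with s hs hs0
      exact (le_div_iff₀ hs0).1 hs
  obtain ⟨c, hc, h⟩ := hev
  obtain ⟨a, ha, hsub⟩ := mem_nhdsGT_iff_exists_Ioc_subset.1 h
  have ha' : (0:ℝ) < a := ha
  refine ⟨c, hc, min a μ', lt_min ha' hμ', (min_le_right _ _).trans_lt hμ, fun s hs hsa => ?_⟩
  exact hsub ⟨hs, hsa.trans (min_le_left _ _)⟩

/-- Theorem 1.1 (first part): under (H1), any nontrivial bounded nonnegative solution of the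
quarter-space problem satisfies
`liminf_{R→∞} inf_{(R,∞)×ℝ^{N-2}×(R,∞)} u ≥ μ`. -/
theorem stmt_0
    (f : ℝ → ℝ) (μ' μ : ℝ) (hf : H1 f μ' μ)
    {N : ℕ} (hN : 2 ≤ N) (i0 iN : Fin N) (hi0 : (i0 : ℕ) = 0) (hiN : (iN : ℕ) = N - 1)
    (u u₀ : (Fin N → ℝ) → ℝ)
    (hu_smooth : ContDiffOn ℝ 2 u {x : Fin N → ℝ | 0 < x i0 ∧ 0 < x iN})
    (hu_cont : ContinuousOn u
      ({x : Fin N → ℝ | 0 ≤ x i0 ∧ 0 ≤ x iN} \ {x : Fin N → ℝ | x i0 = 0 ∧ x iN = 0}))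
    (hu_nonneg : ∀ x : Fin N → ℝ, 0 ≤ x i0 → 0 ≤ x iN → ¬(x i0 = 0 ∧ x iN = 0) → 0 ≤ u x)
    (hu_bdd : ∃ C, ∀ x : Fin N → ℝ, 0 ≤ x i0 → 0 ≤ x iN → ¬(x i0 = 0 ∧ x iN = 0) → u x ≤ C)
    (hu_pde : ∀ x : Fin N → ℝ, 0 < x i0 → 0 < x iN → lap u x + f (u x) = 0)
    (hu_bot : ∀ x : Fin N → ℝ, 0 < x i0 → x iN = 0 → u x = 0)
    (hu_init : ∀ x : Fin N → ℝ, x i0 = 0 → 0 < x iN → u x = u₀ x)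
    (hu₀_cont : ContinuousOn u₀ {x : Fin N → ℝ | x i0 = 0 ∧ 0 < x iN})
    (hu₀_bdd : ∃ C, ∀ x : Fin N → ℝ, x i0 = 0 → 0 < x iN → u₀ x ≤ C)
    (hu₀_nonneg : ∀ x : Fin N → ℝ, x i0 = 0 → 0 < x iN → 0 ≤ u₀ x)
    (hu₀_ne : ∃ x : Fin N → ℝ, x i0 = 0 ∧ 0 < x iN ∧ u₀ x ≠ 0) :
    ∀ δ : ℝ, 0 < δ → ∃ R : ℝ, 0 < R ∧
      ∀ x : Fin N → ℝ, R < x i0 → R < x iN → μ - δ ≤ u x := by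
  intro δ hδ
  obtain ⟨c, hc, s₀, hs₀, hs₀μ, hgrowth⟩ := hf.exists_linear_growth
  obtain ⟨hlip, hμ', hμ, hfpos, -, -, h0⟩ := hf
  have hne : iN ≠ i0 := by
    intro h
    rw [h] at hiN
    omega
  set Ω : Set (Fin N → ℝ) := {x | 0 < x i0 ∧ 0 < x iN} with hΩ_def
  have hopen : ∀ R : ℝ, IsOpen {x : Fin N → ℝ | R < x i0 ∧ R < x iN} := fun R =>
    (isOpen_lt continuous_const (continuous_apply i0)).inter
      (isOpen_lt continuous_const (continuous_apply iN))
  have hΩ : IsOpen Ω := hopen 0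
  have hconv : Convex ℝ Ω :=
    (convex_halfSpace_gt (LinearMap.proj i0 : (Fin N → ℝ) →ₗ[ℝ] ℝ).isLinear 0).inter
      (convex_halfSpace_gt (LinearMap.proj iN : (Fin N → ℝ) →ₗ[ℝ] ℝ).isLinear 0)
  have hu0 : ∀ x ∈ Ω, 0 ≤ u x := fun x hx =>
    hu_nonneg x hx.1.le hx.2.le fun h => hx.1.ne' h.1
  have hpde : ∀ x ∈ Ω, lap u x + f (u x) = 0 := fun x hx => hu_pde x hx.1 hx.2
  have hf0 : 0 ≤ f 0 := h0.elim le_of_lt fun h => h.1.ge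
  have hpos_somewhere : ∃ x ∈ Ω, 0 < u x := by
    obtain ⟨p, hp0, hpN, hpu⟩ := hu₀_ne
    have hup : 0 < u p := by
      rw [hu_init p hp0 hpN]
      exact lt_of_le_of_ne (hu₀_nonneg p hp0 hpN) hpu.symm
    have hpS : p ∈ {x : Fin N → ℝ | 0 ≤ x i0 ∧ 0 ≤ x iN} \
        {x : Fin N → ℝ | x i0 = 0 ∧ x iN = 0} := ⟨⟨hp0.ge, hpN.le⟩, fun h => hpN.ne' h.2⟩
    have htend : Tendsto (fun t : ℝ => Function.update p i0 t) (nhdsWithin 0 (Ioi 0))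
        (nhdsWithin p ({x : Fin N → ℝ | 0 ≤ x i0 ∧ 0 ≤ x iN} \
          {x : Fin N → ℝ | x i0 = 0 ∧ x iN = 0})) := by
      refine tendsto_nhdsWithin_iff.2 ⟨?_, ?_⟩
      · have hc : Continuous fun t : ℝ => Function.update p i0 t := by fun_prop
        have := hc.tendsto 0
        rw [← hp0, Function.update_eq_self, hp0] at this
        exact this.mono_left nhdsWithin_le_nhds
      · filter_upwards [self_mem_nhdsWithin] with t ht
        have ht' : (0:ℝ) < t := ht
        simp [Function.update_of_ne hne, ht'.le, hpN.le, hpN.ne']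
    have hev := ((hu_cont p hpS).tendsto.comp htend).eventually (lt_mem_nhds hup)
    obtain ⟨t, ht, ht0⟩ := (hev.and self_mem_nhdsWithin).exists
    have ht' : (0:ℝ) < t := ht0
    exact ⟨Function.update p i0 t, ⟨by simpa using ht', by simpa [Function.update_of_ne hne]⟩, ht⟩
  have hpos : ∀ x ∈ Ω, 0 < u x := by
    obtain ⟨C, hC⟩ := hu_bdd
    obtain ⟨L, hL⟩ := hlip C
    refine pos_of_exists_pos hΩ hconv.isPreconnected hu_smooth hu0 L.coe_nonneg ?_ hpos_somewhere
    intro x hx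
    have h1 := hu0 x hx
    have h2 := hC x hx.1.le hx.2.le fun h => hx.1.ne' h.1
    have h3 := hL.dist_le_mul (u x) ⟨h1, h2⟩ 0 ⟨le_rfl, h1.trans h2⟩
    rw [Real.dist_eq, Real.dist_eq, sub_zero, abs_of_nonneg h1] at h3
    linarith [neg_abs_le (f (u x) - f 0), hpde x hx]
  obtain ⟨R, hR, hRc⟩ : ∃ R : ℝ, 0 < R ∧ (8 + 4 * (N : ℝ)) ^ 2 < 32 * c * R ^ 2 := by
    have := (tendsto_pow_atTop (α := ℝ) two_ne_zero).const_mul_atTop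
      (by positivity : 0 < 32 * c)
    exact ((eventually_gt_atTop 0).and (this.eventually_gt_atTop _)).exists
  have hball : ∀ (S ρ : ℝ), 0 ≤ ρ → ∀ y : Fin N → ℝ, S + ρ < y i0 → S + ρ < y iN →
      ∀ x, sqDist y x ≤ ρ ^ 2 → S < x i0 ∧ S < x iN := by
    intro S ρ hρ y hy0 hyN x hx
    have h1 := neg_le_of_abs_le (abs_sub_le_of_sqDist_le hρ hx i0)
    have h2 := neg_le_of_abs_le (abs_sub_le_of_sqDist_le hρ hx iN)
    exact ⟨by linarith, by linarith⟩
  have hlow : ∀ x ∈ {x : Fin N → ℝ | R < x i0 ∧ R < x iN}, s₀ ≤ u x := fun x hx =>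
    le_apply_center_of_linear_growth hgrowth hΩ hu_smooth hpos hpde hR hRc
      (hball 0 R hR.le x (by linarith [hx.1]) (by linarith [hx.2]))
  rcases le_or_gt (μ - δ) s₀ with hm | hm
  · exact ⟨R, hR, fun x h1 h2 => hm.trans (hlow x ⟨h1, h2⟩)⟩
  obtain ⟨c₁, hc₁, hfc⟩ : ∃ c₁ > 0, ∀ s, s₀ ≤ s → s ≤ μ - δ → c₁ ≤ f s := by
    obtain ⟨L, hL⟩ := hlip μ
    obtain ⟨s, hs, hmin⟩ := isCompact_Icc.exists_isMinOn (nonempty_Icc.2 hm.le)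
      (hL.continuousOn.mono (Icc_subset_Icc hs₀.le (by linarith)))
    exact ⟨f s, hfpos s (hs₀.trans_le hs.1) (by linarith [hs.2]), fun t h1 h2 => hmin ⟨h1, h2⟩⟩
  obtain ⟨ρ, hρ, hρc⟩ : ∃ ρ : ℝ, 0 < ρ ∧ 2 * N * (μ - δ) < c₁ * ρ ^ 2 := by
    have := (tendsto_pow_atTop (α := ℝ) two_ne_zero).const_mul_atTop hc₁
    exact ((eventually_gt_atTop 0).and (this.eventually_gt_atTop _)).exists
  have hsub : {x : Fin N → ℝ | R < x i0 ∧ R < x iN} ⊆ Ω := fun x hx =>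
    ⟨hR.trans hx.1, hR.trans hx.2⟩
  refine ⟨R + ρ, by positivity, fun x h1 h2 => ?_⟩
  exact le_apply_center_of_lower_bound hs₀ hfc (hopen R) (hu_smooth.mono hsub) hlow
    (fun z hz => hpde z (hsub hz)) (hs₀.trans hm).le hρ hρc (hball R ρ hρ.le x h1 h2)
end
end

section
/- Let N ≥ 2, let f satisfy (H2), and let u be any bounded nonnegative solution of problem (eqbis) in the half-space Ω' with boundary datum u₀ ≢ 0. Then there exists z ∈ E∖{0} such that for all A ∈ ℝ, the translates u(x₁+h, x₂, …, x_N) converge to the constant z as h → +∞ uniformly on [A,+∞) × ℝ^{N-1}, together with all partial derivatives up to order two. -/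
open Set Filter

noncomputable section

open Topology Metric

/-- `g` is differentiable near `t` and its derivative has derivative `a` at `t`. -/
def HasSecondDerivAt (g : ℝ → ℝ) (a t : ℝ) : Prop :=
  ∃ g' : ℝ → ℝ, (∀ᶠ s in 𝓝 t, HasDerivAt g (g' s) s) ∧ HasDerivAt g' a t

namespace HasSecondDerivAt

variable {g k : ℝ → ℝ} {a b t : ℝ}

theorem add (hg : HasSecondDerivAt g a t) (hk : HasSecondDerivAt k b t) :
    HasSecondDerivAt (fun s => g s + k s) (a + b) t := by
  obtain ⟨g', h1, h2⟩ := hg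
  obtain ⟨k', h3, h4⟩ := hk
  refine ⟨fun s => g' s + k' s, ?_, h2.add h4⟩
  filter_upwards [h1, h3] with s hs hs' using hs.add hs'

theorem const_mul (hg : HasSecondDerivAt g a t) (c : ℝ) :
    HasSecondDerivAt (fun s => c * g s) (c * a) t := by
  obtain ⟨g', h1, h2⟩ := hg
  refine ⟨fun s => c * g' s, ?_, h2.const_mul c⟩
  filter_upwards [h1] with s hs using hs.const_mul c

theorem const (c t : ℝ) : HasSecondDerivAt (fun _ => c) 0 t :=
  ⟨fun _ => 0, Eventually.of_forall fun s => hasDerivAt_const s c, hasDerivAt_const t 0⟩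

theorem comp_add_const {c : ℝ} (hg : HasSecondDerivAt g a (t + c)) :
    HasSecondDerivAt (fun s => g (s + c)) a t := by
  obtain ⟨g', h1, h2⟩ := hg
  refine ⟨fun s => g' (s + c), ?_, h2.comp_add_const t c⟩
  have : Tendsto (fun s => s + c) (𝓝 t) (𝓝 (t + c)) :=
    (continuous_id.add continuous_const).continuousAt
  filter_upwards [this.eventually h1] with s hs using hs.comp_add_const s c

theorem comp_const_sub {c : ℝ} (hg : HasSecondDerivAt g a (c - t)) :
    HasSecondDerivAt (fun s => g (c - s)) a t := by
  obtain ⟨g', h1, h2⟩ := hg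
  refine ⟨fun s => -g' (c - s), ?_, (h2.comp_const_sub c t).neg.congr_deriv (neg_neg a)⟩
  have : Tendsto (fun s => c - s) (𝓝 t) (𝓝 (c - t)) :=
    (continuous_const.sub continuous_id).continuousAt
  filter_upwards [this.eventually h1] with s hs using hs.comp_const_sub c s

theorem congr (hg : HasSecondDerivAt g a t) (h : ∀ s, k s = g s) (hab : b = a) :
    HasSecondDerivAt k b t := by
  obtain rfl : k = g := funext h
  rwa [hab]

/-- A quadratic polynomial centred at `c`. -/
theorem quadratic (α β γ c t : ℝ) :
    HasSecondDerivAt (fun s => α * (s - c) ^ 2 + β * (s - c) + γ) (2 * α) t := by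
  refine ⟨fun s => 2 * α * (s - c) + β, Eventually.of_forall fun s => ?_, ?_⟩
  · have h := (hasDerivAt_id s).sub_const c
    refine ((((h.pow 2).const_mul α).add (h.const_mul β)).add_const γ).congr_deriv ?_
    simp; ring
  · have h := (hasDerivAt_id t).sub_const c
    refine ((h.const_mul (2 * α)).add_const β).congr_deriv ?_
    simp

theorem nonneg_of_isLocalMin (hg : HasSecondDerivAt g a t) (hmin : IsLocalMin g t) : 0 ≤ a := by
  obtain ⟨g', h1, h2⟩ := hg
  by_contra! ha
  have hd : deriv g =ᶠ[𝓝 t] g' := h1.mono fun s hs => hs.deriv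
  have hdd : deriv (deriv g) t = a := by rw [hd.deriv_eq, h2.deriv]
  have hmax : IsLocalMax g t :=
    isLocalMax_of_deriv_deriv_neg (by rw [hdd]; exact ha) hmin.deriv_eq_zero
      h1.self_of_nhds.continuousAt
  have heq : g =ᶠ[𝓝 t] fun _ => g t := by
    filter_upwards [hmin, hmax] with s hs hs' using le_antisymm hs' hs
  have h0 : deriv g =ᶠ[𝓝 t] fun _ => 0 := by simpa using heq.deriv
  have : deriv (deriv g) t = 0 := by rw [h0.deriv_eq]; simp
  linarith

end HasSecondDerivAt

/-- `w` has pure second partial derivatives at `x`, and their sum is `l`. -/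
def HasLap {N : ℕ} (w : (Fin N → ℝ) → ℝ) (l : ℝ) (x : Fin N → ℝ) : Prop :=
  ∃ q : Fin N → ℝ,
    (∀ j, HasSecondDerivAt (fun t => w (Function.update x j t)) (q j) (x j)) ∧ ∑ j, q j = l

namespace HasLap

variable {N : ℕ} {w v : (Fin N → ℝ) → ℝ} {l m : ℝ} {x : Fin N → ℝ}

theorem add (hw : HasLap w l x) (hv : HasLap v m x) :
    HasLap (fun y => w y + v y) (l + m) x := by
  obtain ⟨q, h1, rfl⟩ := hw
  obtain ⟨r, h2, rfl⟩ := hv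
  exact ⟨fun j => q j + r j, fun j => (h1 j).add (h2 j), Finset.sum_add_distrib⟩

theorem const_mul (hw : HasLap w l x) (c : ℝ) : HasLap (fun y => c * w y) (c * l) x := by
  obtain ⟨q, h1, rfl⟩ := hw
  exact ⟨fun j => c * q j, fun j => (h1 j).const_mul c, (Finset.mul_sum _ _ _).symm⟩

theorem neg (hw : HasLap w l x) : HasLap (fun y => -w y) (-l) x := by
  simpa using hw.const_mul (-1)

theorem sub (hw : HasLap w l x) (hv : HasLap v m x) :
    HasLap (fun y => w y - v y) (l - m) x := by
  simpa [sub_eq_add_neg] using hw.add hv.neg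

theorem const (c : ℝ) (x : Fin N → ℝ) : HasLap (fun _ => c) 0 x :=
  ⟨fun _ => 0, fun _ => HasSecondDerivAt.const _ _, by simp⟩

theorem comp_add_const {e : Fin N → ℝ} (hw : HasLap w l (x + e)) :
    HasLap (fun y => w (y + e)) l x := by
  obtain ⟨q, h1, rfl⟩ := hw
  refine ⟨q, fun j => ?_, rfl⟩
  refine (HasSecondDerivAt.comp_add_const (c := e j) (h1 j)).congr (fun s => ?_) rfl
  refine congrArg w (funext fun k => ?_)
  rcases eq_or_ne k j with rfl | hk <;> simp [*]

theorem comp_reflect {i : Fin N} {c : ℝ} (hw : HasLap w l (Function.update x i (c - x i))) :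
    HasLap (fun y => w (Function.update y i (c - y i))) l x := by
  obtain ⟨q, h1, rfl⟩ := hw
  refine ⟨q, fun j => ?_, rfl⟩
  rcases eq_or_ne j i with rfl | hj
  · have := h1 j
    simp only [Function.update_self, Function.update_idem] at this
    exact this.comp_const_sub.congr (fun s => by simp) rfl
  · have := h1 j
    rw [Function.update_of_ne hj] at this
    refine this.congr (fun s => ?_) rfl
    beta_reduce
    rw [Function.update_of_ne hj.symm, Function.update_comm hj]

theorem comp_eval {g : ℝ → ℝ} {a : ℝ} {i : Fin N} (hg : HasSecondDerivAt g a (x i)) :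
    HasLap (fun y : Fin N → ℝ => g (y i)) a x := by
  refine ⟨fun j => if j = i then a else 0, fun j => ?_, by simp⟩
  rcases eq_or_ne j i with rfl | hj
  · simpa using hg
  · simpa [hj, Function.update_of_ne hj.symm] using HasSecondDerivAt.const _ _

theorem nonneg_of_isLocalMin (hw : HasLap w l x) (hmin : IsLocalMin w x) : 0 ≤ l := by
  obtain ⟨q, h1, rfl⟩ := hw
  refine Finset.sum_nonneg fun j _ => (h1 j).nonneg_of_isLocalMin ?_
  have hc : Tendsto (Function.update x j) (𝓝 (x j)) (𝓝 x) := by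
    simpa using (hasDerivAt_update x j (x j)).continuousAt.tendsto
  filter_upwards [hc.eventually hmin] with s hs
  simpa using hs

end HasLap

theorem sum_update_sub_sq {N : ℕ} (x p : Fin N → ℝ) (j : Fin N) (t : ℝ) :
    ∑ k, (Function.update x j t k - p k) ^ 2
      = (t - p j) ^ 2 + (∑ k, (x k - p k) ^ 2 - (x j - p j) ^ 2) := by
  rw [← Finset.add_sum_erase _ _ (Finset.mem_univ j),
    ← Finset.add_sum_erase _ (fun k => (x k - p k) ^ 2) (Finset.mem_univ j)]
  have : ∑ k ∈ Finset.univ.erase j, (Function.update x j t k - p k) ^ 2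
      = ∑ k ∈ Finset.univ.erase j, (x k - p k) ^ 2 :=
    Finset.sum_congr rfl fun k hk => by
      rw [Function.update_of_ne (Finset.ne_of_mem_erase hk)]
  rw [this]
  simp

theorem hasLap_sum_sq {N : ℕ} (p x : Fin N → ℝ) :
    HasLap (fun y => ∑ k, (y k - p k) ^ 2) (2 * N) x := by
  refine ⟨fun _ => 2, fun j => ?_, by simp; ring⟩
  refine (HasSecondDerivAt.quadratic 1 0 (∑ k, (x k - p k) ^ 2 - (x j - p j) ^ 2) (p j)
    (x j)).congr (fun s => ?_) (by ring)
  beta_reduce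
  rw [sum_update_sub_sq]; ring

/-- The Gaussian `exp (-a |y - p|²)`, with `|·|` the Euclidean norm. -/
def gauss {N : ℕ} (a : ℝ) (p y : Fin N → ℝ) : ℝ := Real.exp (-a * ∑ k, (y k - p k) ^ 2)

theorem continuous_gauss {N : ℕ} (a : ℝ) (p : Fin N → ℝ) : Continuous (gauss a p) := by
  unfold gauss; fun_prop

theorem hasLap_gauss {N : ℕ} (a : ℝ) (p x : Fin N → ℝ) :
    HasLap (gauss a p) ((4 * a ^ 2 * ∑ k, (x k - p k) ^ 2 - 2 * a * N) * gauss a p x) x := by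
  refine ⟨fun j => (4 * a ^ 2 * (x j - p j) ^ 2 - 2 * a) * gauss a p x, fun j => ?_, ?_⟩
  · set S := ∑ k, (x k - p k) ^ 2 - (x j - p j) ^ 2 with hS
    have key : ∀ s, gauss a p (Function.update x j s)
        = Real.exp (-a * ((s - p j) ^ 2 + S)) := fun s => by
      rw [gauss, sum_update_sub_sq]
    have hx : gauss a p x = Real.exp (-a * ((x j - p j) ^ 2 + S)) := by
      rw [← key, Function.update_eq_self]
    have h1 : ∀ s, HasDerivAt (fun s => Real.exp (-a * ((s - p j) ^ 2 + S)))
        (-2 * a * (s - p j) * Real.exp (-a * ((s - p j) ^ 2 + S))) s := fun s => by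
      have h := (hasDerivAt_id s).sub_const (p j)
      refine (((h.pow 2).add_const S).const_mul (-a)).exp.congr_deriv ?_
      simp; ring
    refine HasSecondDerivAt.congr ⟨_, Eventually.of_forall h1, ?_⟩ key rfl
    have h := ((hasDerivAt_id (x j)).sub_const (p j)).const_mul (-2 * a)
    refine (h.mul (h1 (x j))).congr_deriv ?_
    rw [hx]; simp; ring
  · rw [← Finset.sum_mul, Finset.sum_sub_distrib, ← Finset.mul_sum]
    simp only [Finset.sum_const, Finset.card_univ, Fintype.card_fin, nsmul_eq_mul]
    ring

theorem exists_sq_le_of_notMem_ball {N : ℕ} {p x : Fin N → ℝ} {d : ℝ} (hd : 0 < d)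
    (hx : x ∉ ball p d) : d ^ 2 ≤ ∑ k, (x k - p k) ^ 2 := by
  rw [mem_ball, dist_pi_lt_iff hd] at hx
  push Not at hx
  obtain ⟨j, hj⟩ := hx
  rw [Real.dist_eq] at hj
  calc d ^ 2 ≤ |x j - p j| ^ 2 := by gcongr
    _ = (x j - p j) ^ 2 := sq_abs _
    _ ≤ _ := Finset.single_le_sum (f := fun k => (x k - p k) ^ 2) (fun k _ => sq_nonneg _)
      (Finset.mem_univ j)

theorem sum_sq_le_of_mem_closedBall {N : ℕ} {p x : Fin N → ℝ} {d : ℝ}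
    (hx : x ∈ closedBall p d) : ∑ k, (x k - p k) ^ 2 ≤ N * d ^ 2 := by
  calc ∑ k, (x k - p k) ^ 2 ≤ ∑ _k : Fin N, d ^ 2 := by
        refine Finset.sum_le_sum fun k _ => ?_
        rw [← sq_abs, ← Real.dist_eq]
        have := (dist_le_pi_dist x p k).trans hx
        gcongr
    _ = _ := by simp

theorem nonneg_of_hasDerivAt_of_nonneg_right {F : ℝ → ℝ} {a d : ℝ} (hd : 0 < d)
    (hF : HasDerivAt F a 0) (h0 : F 0 = 0) (hpos : ∀ t, 0 < t → t ≤ d → 0 ≤ F t) : 0 ≤ a := by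
  have h := hF.hasDerivWithinAt (s := Ioi 0)
  rw [hasDerivWithinAt_iff_tendsto_slope' self_notMem_Ioi] at h
  refine ge_of_tendsto h ?_
  filter_upwards [Ioc_mem_nhdsGT hd] with t ht
  rw [slope_def_field, h0, sub_zero, sub_zero]
  exact div_nonneg (hpos t ht.1 ht.2) ht.1.le

theorem odd_part_le_barrier {N : ℕ} {w lw : (Fin N → ℝ) → ℝ} {p : Fin N → ℝ} {d M K : ℝ}
    (hd : 0 < d) (hc : ContinuousOn w (closedBall p d))
    (hl : ∀ x ∈ closedBall p d, HasLap w (lw x) x) (hK : ∀ x ∈ closedBall p d, |lw x| < K)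
    (hM : ∀ x ∈ closedBall p d, |w x| ≤ M) (i : Fin N) {x : Fin N → ℝ}
    (hx : x ∈ closedBall p d) (hxi : p i ≤ x i) :
    1 / 2 * (w x - w (Function.update x i (2 * p i - x i))) ≤
      M / d ^ 2 * (∑ k, (x k - p k) ^ 2 + (-N * (x i - p i) ^ 2 + N * d * (x i - p i) + 0))
        + (-(K / 2) * (x i - p i) ^ 2 + K / 2 * d * (x i - p i) + 0) := by
  set R : (Fin N → ℝ) → (Fin N → ℝ) := fun x => Function.update x i (2 * p i - x i) with hR
  set H : Set (Fin N → ℝ) := closedBall p d ∩ {x | p i ≤ x i} with hH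
  have hRmem : ∀ x ∈ closedBall p d, R x ∈ closedBall p d := fun x hx => by
    rw [mem_closedBall, dist_pi_le_iff hd.le] at hx ⊢
    intro k
    rcases eq_or_ne k i with rfl | hk
    · have := hx k
      rw [Real.dist_eq] at this ⊢
      rw [hR, ← abs_neg]
      simp only [Function.update_self]
      convert this using 2; ring
    · simpa [hR, hk] using hx k
  have hRc : Continuous R := by
    refine continuous_id.update i ?_
    fun_prop
  set φ : (Fin N → ℝ) → ℝ := fun x => 1 / 2 * (w x - w (R x)) with hφ
  set ψ : (Fin N → ℝ) → ℝ := fun x =>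
      M / d ^ 2 * (∑ k, (x k - p k) ^ 2 + (-N * (x i - p i) ^ 2 + N * d * (x i - p i) + 0))
        + (-(K / 2) * (x i - p i) ^ 2 + K / 2 * d * (x i - p i) + 0) with hψ
  have hHc : IsCompact H :=
    (isCompact_closedBall p d).inter_right (isClosed_le continuous_const (continuous_apply i))
  have hcont : ContinuousOn (fun x => ψ x - φ x) H := by
    refine ContinuousOn.sub (by fun_prop) (ContinuousOn.const_smul (c := (1 / 2 : ℝ)) ?_)
    exact (hc.mono inter_subset_left).sub
      (hc.comp hRc.continuousOn fun x hx => hRmem x hx.1)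
  have hM0 : 0 ≤ M := (abs_nonneg _).trans (hM x hx)
  have hK0 : 0 < K := (abs_nonneg _).trans_lt (hK x hx)
  obtain ⟨y, hyH, hy⟩ := hHc.exists_isMinOn ⟨x, hx, hxi⟩ hcont
  suffices h : 0 ≤ ψ y - φ y by
    have h1 : ψ y - φ y ≤ ψ x - φ x := hy (show x ∈ H from ⟨hx, hxi⟩)
    exact sub_nonneg.1 (h.trans h1)
  by_contra! hneg
  have hyi : 0 ≤ y i - p i := sub_nonneg.2 hyH.2
  have hyd : y i - p i ≤ d := by
    have := (dist_le_pi_dist y p i).trans hyH.1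
    rw [Real.dist_eq] at this
    exact (le_abs_self _).trans this
  have hq : 0 ≤ (y i - p i) * (d - (y i - p i)) := mul_nonneg hyi (sub_nonneg.2 hyd)
  have hψy : ψ y = M / d ^ 2 * ∑ k, (y k - p k) ^ 2
      + (M / d ^ 2 * N + K / 2) * ((y i - p i) * (d - (y i - p i))) := by
    simp only [hψ]; ring
  have hq' : 0 ≤ (M / d ^ 2 * N + K / 2) * ((y i - p i) * (d - (y i - p i))) := by positivity
  have hyi' : p i < y i := by
    refine lt_of_le_of_ne hyH.2 fun he => ?_
    have hRy : R y = y := by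
      simp only [hR]; rw [he]; convert Function.update_eq_self i y using 2; ring
    have : φ y = 0 := by simp [hφ, hRy]
    have : 0 ≤ M / d ^ 2 * ∑ k, (y k - p k) ^ 2 := by positivity
    linarith
  have hyb : y ∈ ball p d := by
    by_contra hyb
    have h1 := exists_sq_le_of_notMem_ball hd hyb
    have h2 : M ≤ M / d ^ 2 * ∑ k, (y k - p k) ^ 2 := by
      calc M = M / d ^ 2 * d ^ 2 := by field_simp
        _ ≤ _ := by gcongr
    have h3 := abs_le.1 (hM y hyH.1)
    have h4 := abs_le.1 (hM _ (hRmem y hyH.1))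
    have : φ y ≤ M := by simp only [hφ]; linarith
    linarith
  have hnhds : H ∈ 𝓝 y := by
    have hopen : IsOpen {z : Fin N → ℝ | p i < z i} :=
      isOpen_lt continuous_const (continuous_apply i)
    refine mem_of_superset ((isOpen_ball.inter hopen).mem_nhds ⟨hyb, hyi'⟩) ?_
    exact inter_subset_inter ball_subset_closedBall fun z (hz : p i < z i) => hz.le
  have hlapψ : HasLap ψ (M / d ^ 2 * (2 * N + 2 * -N) + 2 * -(K / 2)) y :=
    (((hasLap_sum_sq p y).add (HasLap.comp_eval (HasSecondDerivAt.quadratic _ _ _ _ _))).const_mul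
      _).add (HasLap.comp_eval (HasSecondDerivAt.quadratic _ _ _ _ _))
  have hlapφ : HasLap φ (1 / 2 * (lw y - lw (R y))) y :=
    ((hl y hyH.1).sub (hl _ (hRmem y hyH.1)).comp_reflect).const_mul _
  have hfin := (hlapψ.sub hlapφ).nonneg_of_isLocalMin (hy.isLocalMin hnhds)
  have h1 := abs_lt.1 (hK y hyH.1)
  have h2 := abs_lt.1 (hK _ (hRmem y hyH.1))
  have h3 : M / d ^ 2 * (2 * N + 2 * -N) = 0 := by ring
  linarith

/-- Interior gradient estimate on a cube, for a function with bounded Laplacian. -/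
theorem abs_deriv_le_of_hasLap {N : ℕ} {w lw : (Fin N → ℝ) → ℝ} {p : Fin N → ℝ} {d M K D : ℝ}
    (hd : 0 < d) (hc : ContinuousOn w (closedBall p d))
    (hl : ∀ x ∈ closedBall p d, HasLap w (lw x) x) (hK : ∀ x ∈ closedBall p d, |lw x| < K)
    (hM : ∀ x ∈ closedBall p d, |w x| ≤ M) (i : Fin N)
    (hD : HasDerivAt (fun t => w (Function.update p i t)) D (p i)) :
    |D| ≤ N * M / d + K / 2 * d := by
  have key : ∀ (w lw : (Fin N → ℝ) → ℝ) (D : ℝ), ContinuousOn w (closedBall p d) →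
      (∀ x ∈ closedBall p d, HasLap w (lw x) x) → (∀ x ∈ closedBall p d, |lw x| < K) →
      (∀ x ∈ closedBall p d, |w x| ≤ M) →
      HasDerivAt (fun t => w (Function.update p i t)) D (p i) →
      D ≤ N * M / d + K / 2 * d := by
    intro w lw D hc hl hK hM hD
    rw [← sub_nonneg]
    refine nonneg_of_hasDerivAt_of_nonneg_right hd (F := fun t =>
      ((M / d ^ 2 * (1 - N) - K / 2) * t ^ 2 + (N * M / d + K / 2 * d) * t) -
        1 / 2 * (w (Function.update p i (p i + t)) - w (Function.update p i (p i - t)))) ?_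
      (by simp) ?_
    · have h1 : HasDerivAt (fun t => w (Function.update p i (p i + t))) D 0 :=
        HasDerivAt.comp_const_add (p i) 0 (by simpa using hD)
      have h2 : HasDerivAt (fun t => w (Function.update p i (p i - t))) (-D) 0 :=
        HasDerivAt.comp_const_sub (p i) 0 (by simpa using hD)
      refine ((((hasDerivAt_pow 2 (0 : ℝ)).const_mul _).add ((hasDerivAt_id _).const_mul _)).sub
        ((h1.sub h2).const_mul (1 / 2))).congr_deriv ?_
      simp; ring
    · intro t ht htd
      have hmem : Function.update p i (p i + t) ∈ closedBall p d := by
        rw [mem_closedBall, dist_pi_le_iff hd.le]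
        intro k
        rcases eq_or_ne k i with rfl | hk
        · simpa [Real.dist_eq, abs_of_pos ht] using htd
        · simp [hk, hd.le]
      have h := odd_part_le_barrier hd hc hl hK hM i hmem (by simpa using ht.le)
      rw [sum_update_sub_sq] at h
      simp only [Function.update_self, Function.update_idem, sub_self, add_sub_cancel_left] at h
      have e : 2 * p i - (p i + t) = p i - t := by ring
      rw [e] at h
      simp only [ne_eq, OfNat.ofNat_ne_zero, not_false_eq_true, zero_pow, sub_zero,
        Finset.sum_const_zero, add_zero] at h
      have e2 : N * M / d * t = M / d ^ 2 * (N * d * t) := by field_simp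
      linarith
  refine abs_le.2 ⟨?_, key w lw D hc hl hK hM hD⟩
  have := key (fun x => -w x) (fun x => -lw x) (-D) hc.neg (fun x hx => (hl x hx).neg)
    (fun x hx => by simpa using hK x hx) (fun x hx => by simpa using hM x hx) hD.neg
  linarith

theorem gauss_le_one {N : ℕ} {a : ℝ} (ha : 0 ≤ a) (p y : Fin N → ℝ) : gauss a p y ≤ 1 := by
  rw [gauss, Real.exp_le_one_iff, neg_mul, neg_nonpos]
  exact mul_nonneg ha (Finset.sum_nonneg fun k _ => sq_nonneg _)

/-- Lower bound for a superharmonic function on a ball, given a larger lower bound on a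
concentric smaller ball. -/
theorem gauss_barrier_le {N : ℕ} {w lw : (Fin N → ℝ) → ℝ} {p : Fin N → ℝ} {r R A m δ : ℝ}
    (hr : 0 < r) (hR : 0 < R) (hA : 0 < A) (hAr : N < 2 * A * r ^ 2) (hδ : 0 < δ)
    (hc : ContinuousOn w (closedBall p R))
    (hl : ∀ x ∈ ball p R, HasLap w (lw x) x) (hsup : ∀ x ∈ ball p R, lw x ≤ 0)
    (hm : ∀ x ∈ closedBall p R, m ≤ w x) (hmr : ∀ x ∈ ball p r, m + δ ≤ w x)
    {x : Fin N → ℝ} (hx : x ∈ closedBall p R) :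
    m + δ * (gauss A p x - Real.exp (-A * R ^ 2)) ≤ w x := by
  have hcont : ContinuousOn (fun x => w x - δ * gauss A p x) (closedBall p R) :=
    hc.sub ((continuous_gauss A p).const_mul δ).continuousOn
  obtain ⟨y, hyR, hy⟩ := (isCompact_closedBall p R).exists_isMinOn ⟨x, hx⟩ hcont
  have hyx : w y - δ * gauss A p y ≤ w x - δ * gauss A p x := hy hx
  suffices h : m + δ * (gauss A p y - Real.exp (-A * R ^ 2)) ≤ w y by linarith
  by_cases hyb : y ∈ ball p R
  · by_cases hyr : y ∈ ball p r
    · have h1 := hmr y hyr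
      have h2 := gauss_le_one hA.le p y
      nlinarith [Real.exp_pos (-A * R ^ 2)]
    · have h1 := exists_sq_le_of_notMem_ball hr hyr
      have hmin : IsLocalMin (fun x => w x - δ * gauss A p x) y :=
        hy.isLocalMin (mem_of_superset (isOpen_ball.mem_nhds hyb) ball_subset_closedBall)
      have h2 := ((hl y hyb).sub ((hasLap_gauss A p y).const_mul δ)).nonneg_of_isLocalMin hmin
      have h3 := hsup y hyb
      have h4 : 0 < 4 * A ^ 2 * ∑ k, (y k - p k) ^ 2 - 2 * A * N := by
        have : 4 * A ^ 2 * r ^ 2 ≤ 4 * A ^ 2 * ∑ k, (y k - p k) ^ 2 := by gcongr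
        nlinarith
      have h5 : 0 < gauss A p y := Real.exp_pos _
      have := mul_pos hδ (mul_pos h4 h5)
      linarith
  · have h1 := exists_sq_le_of_notMem_ball hR hyb
    have h2 : gauss A p y ≤ Real.exp (-A * R ^ 2) := by
      rw [gauss, Real.exp_le_exp]; nlinarith
    have h3 := hm y hyR
    nlinarith

theorem exists_gauss_subsolution (N : ℕ) {c : ℝ} (hc : 0 < c) :
    ∃ a κ R : ℝ, 0 < a ∧ 0 < κ ∧ κ ≤ 1 / 2 ∧ 0 < R ∧ ∀ p y : Fin N → ℝ,
      (gauss a p y ≤ κ →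
        0 < (4 * a ^ 2 * ∑ k, (y k - p k) ^ 2 - 2 * a * N) * gauss a p y) ∧
      (κ < gauss a p y →
        0 < (4 * a ^ 2 * ∑ k, (y k - p k) ^ 2 - 2 * a * N) * gauss a p y
          + c * (gauss a p y - κ)) ∧
      (y ∉ ball p R → gauss a p y ≤ κ / 2) := by
  set a : ℝ := c / (8 * (N + 1)) with ha
  set κ : ℝ := Real.exp (-(N / 2)) / 2 with hκ
  have ha0 : 0 < a := by positivity
  have hκ0 : 0 < κ := by positivity
  have haN : 2 * a * N ≤ c / 4 := by
    have : a * (8 * (N + 1)) = c := by rw [ha]; field_simp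
    linarith
  refine ⟨a, κ, 1 + |Real.log (κ / 2)| / a, ha0, hκ0, ?_, by positivity, fun p y => ?_⟩
  · have : Real.exp (-(N / 2 : ℝ)) ≤ 1 := by
      rw [Real.exp_le_one_iff, neg_nonpos]; positivity
    linarith
  set S := ∑ k, (y k - p k) ^ 2 with hS
  have hG0 : 0 < gauss a p y := Real.exp_pos _
  have hfar : N / 2 < a * S → 0 < (4 * a ^ 2 * S - 2 * a * N) * gauss a p y := fun h =>
    mul_pos (by nlinarith) hG0
  refine ⟨fun h => hfar ?_, fun h => ?_, fun h => ?_⟩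
  · have : Real.exp (-a * S) < Real.exp (-(N / 2)) := by
      have : Real.exp (-a * S) ≤ κ := h
      linarith
    rw [Real.exp_lt_exp] at this
    linarith
  · by_cases h1 : N / 2 < a * S
    · have := hfar h1
      have := mul_pos hc (sub_pos.2 h)
      linarith
    · have h2 : 2 * κ ≤ gauss a p y := by
        have : Real.exp (-(N / 2)) ≤ Real.exp (-a * S) := by
          rw [Real.exp_le_exp]; linarith
        rw [gauss]; linarith
      have h3 : 0 ≤ 4 * a ^ 2 * S * gauss a p y := by
        have : 0 ≤ S := Finset.sum_nonneg fun k _ => sq_nonneg _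
        positivity
      have h4 : 2 * a * N * gauss a p y ≤ c / 4 * gauss a p y := by gcongr
      have h5 : c * (2 * κ) ≤ c * gauss a p y := by gcongr
      have h6 := mul_pos hc hκ0
      linarith
  · have h1 := exists_sq_le_of_notMem_ball (by positivity) h
    rw [gauss, ← Real.le_log_iff_exp_le (by positivity)]
    have h2 := neg_abs_le (Real.log (κ / 2))
    have h3 : |Real.log (κ / 2)| ≤ a * (1 + |Real.log (κ / 2)| / a) ^ 2 := by
      have h4 : (|Real.log (κ / 2)| / a) ≤ (1 + |Real.log (κ / 2)| / a) ^ 2 := by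
        have : 0 ≤ |Real.log (κ / 2)| / a := by positivity
        nlinarith
      calc |Real.log (κ / 2)| = a * (|Real.log (κ / 2)| / a) := by field_simp
        _ ≤ _ := by gcongr
    have h4 : a * (1 + |Real.log (κ / 2)| / a) ^ 2 ≤ a * S := by gcongr
    linarith

theorem le_coord_of_mem_closedBall {N : ℕ} {i : Fin N} {x y : Fin N → ℝ} {R h : ℝ}
    (hx : x ∈ closedBall y R) (hy : h + R ≤ y i) : h ≤ x i := by
  have := (dist_le_pi_dist x y i).trans hx
  rw [Real.dist_eq] at this
  linarith [(abs_le.1 this).1]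

/-- `u` is a nonnegative solution of `Δu + f(u) = 0` in the open half-space `x i₀ > 0`, for a
nonlinearity `f` which is nonnegative on `[0, ∞)`. -/
structure IsHalfSpaceSol {N : ℕ} (f : ℝ → ℝ) (i₀ : Fin N) (u : (Fin N → ℝ) → ℝ) : Prop where
  f_nonneg : ∀ s, 0 ≤ s → 0 ≤ f s
  cont : ContinuousOn u {x | 0 < x i₀}
  hasLap : ∀ x : Fin N → ℝ, 0 < x i₀ → HasLap u (-f (u x)) x
  nonneg : ∀ x : Fin N → ℝ, 0 < x i₀ → 0 ≤ u x

namespace IsHalfSpaceSol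

variable {N : ℕ} {f : ℝ → ℝ} {i₀ : Fin N} {u : (Fin N → ℝ) → ℝ}

theorem continuousOn_closedBall (hu : IsHalfSpaceSol f i₀ u) {h R : ℝ} {y : Fin N → ℝ}
    (hh : 0 < h) (hy : h + R ≤ y i₀) : ContinuousOn u (closedBall y R) :=
  hu.cont.mono fun _ hx => hh.trans_le (le_coord_of_mem_closedBall hx hy)

theorem gauss_barrier_le (hu : IsHalfSpaceSol f i₀ u) {p : Fin N → ℝ} {h r R A m δ : ℝ}
    (hh : 0 < h) (hp : h + R ≤ p i₀)
    (hr : 0 < r) (hR : 0 < R) (hA : 0 < A) (hAr : N < 2 * A * r ^ 2) (hδ : 0 < δ)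
    (hm : ∀ x ∈ closedBall p R, m ≤ u x) (hmr : ∀ x ∈ ball p r, m + δ ≤ u x)
    {x : Fin N → ℝ} (hx : x ∈ closedBall p R) :
    m + δ * (gauss A p x - Real.exp (-A * R ^ 2)) ≤ u x := by
  have hpos : ∀ x ∈ ball p R, 0 < x i₀ := fun x hx =>
    hh.trans_le (le_coord_of_mem_closedBall (ball_subset_closedBall hx) hp)
  exact _root_.gauss_barrier_le hr hR hA hAr hδ (hu.continuousOn_closedBall hh hp)
    (fun x hx => hu.hasLap x (hpos x hx))
    (fun x hx => neg_nonpos.2 (hu.f_nonneg _ (hu.nonneg x (hpos x hx)))) hm hmr hx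

/-- Spreading: above a zero `z` of `f` which is unstable from the right, a solution which is
larger than `z + ε` on one large ball is larger than `z + ε / 2` everywhere. -/
theorem spreading (hu : IsHalfSpaceSol f i₀ u) {z c s₀ : ℝ} (hc : 0 < c)
    (hf : ∀ s, z < s → s ≤ z + s₀ → c * (s - z) ≤ f s) :
    ∃ κ R : ℝ, 0 < κ ∧ κ ≤ 1 / 2 ∧ 0 < R ∧ ∀ ε h : ℝ, 0 < ε → ε ≤ s₀ → 0 < h →
      (∀ x : Fin N → ℝ, h ≤ x i₀ → z - ε * κ / 2 < u x) →
      (∃ y : Fin N → ℝ, h + R ≤ y i₀ ∧ ∀ x ∈ closedBall y R, z + ε ≤ u x) →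
      ∀ y : Fin N → ℝ, h + R ≤ y i₀ → z + ε / 2 ≤ u y := by
  obtain ⟨a, κ, R, ha, hκ, hκ2, hR, hG⟩ := exists_gauss_subsolution N hc
  refine ⟨κ, R, hκ, hκ2, hR, fun ε h hε hεs hh hlow ⟨y₀, hy₀, hstart⟩ => ?_⟩
  have no_touch : ∀ y : Fin N → ℝ, h + R ≤ y i₀ → ∀ x ∈ closedBall y R,
      (∀ x' ∈ closedBall y R, 0 ≤ u x' - (z + ε * (gauss a y x' - κ))) →
      u x - (z + ε * (gauss a y x - κ)) ≠ 0 := by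
    intro y hy x hx hmin h0
    obtain ⟨g1, g2, g3⟩ := hG y x
    have hxh := le_coord_of_mem_closedBall hx hy
    have hxb : x ∈ ball y R := by
      by_contra hxb
      have h1 := g3 hxb
      have h2 := hlow x hxh
      have h3 : ε * (gauss a y x - κ) ≤ ε * (κ / 2 - κ) := by gcongr
      linarith
    have hloc : IsLocalMin (fun x => u x - (z + ε * (gauss a y x - κ))) x := by
      filter_upwards [isOpen_ball.mem_nhds hxb] with x' hx'
      rw [h0]
      exact hmin x' (ball_subset_closedBall hx')
    have hlap := ((hu.hasLap x (hh.trans_le hxh)).sub ((HasLap.const z x).add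
      (((hasLap_gauss a y x).sub (HasLap.const κ x)).const_mul ε))).nonneg_of_isLocalMin hloc
    have hux : u x = z + ε * (gauss a y x - κ) := by linarith
    rcases le_or_gt (gauss a y x) κ with hle | hgt
    · have h1 := mul_pos hε (g1 hle)
      have h2 := hu.f_nonneg _ (hu.nonneg x (hh.trans_le hxh))
      linarith
    · have hpos := mul_pos hε (sub_pos.2 hgt)
      have h1 := mul_pos hε (g2 hgt)
      have h2 : ε * (gauss a y x - κ) ≤ ε * 1 := by
        gcongr; linarith [gauss_le_one ha.le y x]
      have h3 := hf (u x) (by linarith) (by linarith)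
      have h4 : u x - z = ε * (gauss a y x - κ) := by linarith
      rw [h4] at h3
      linarith
  set U : (Fin N → ℝ) → ℝ := fun x => u (Function.update x i₀ (max h (x i₀))) with hU
  have hUu : ∀ x : Fin N → ℝ, h ≤ x i₀ → U x = u x := fun x hx => by
    simp [hU, max_eq_right hx]
  have hUc : Continuous U := by
    refine hu.cont.comp_continuous (continuous_id.update i₀ (by fun_prop)) fun x => ?_
    simpa using Or.inl hh
  set F : (Fin N → ℝ) → (Fin N → ℝ) → ℝ :=
    fun y x => U (x + y) - (z + ε * (gauss a y (x + y) - κ)) with hF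
  have hFc : Continuous (Function.uncurry F) := by
    simp only [hF, gauss, Function.uncurry_def]
    fun_prop
  have hFcy : ∀ y, Continuous (F y) := fun y => hFc.comp (by fun_prop : Continuous fun x => (y, x))
  set m : (Fin N → ℝ) → ℝ := fun y => sInf (F y '' closedBall 0 R) with hm
  have hK := isCompact_closedBall (0 : Fin N → ℝ) R
  have hmc : Continuous m := hK.continuous_sInf hFc
  have hne : (closedBall (0 : Fin N → ℝ) R).Nonempty := ⟨0, by simp [hR.le]⟩
  have hatt : ∀ y, ∃ x ∈ closedBall (0 : Fin N → ℝ) R, m y = F y x ∧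
      ∀ x' ∈ closedBall (0 : Fin N → ℝ) R, m y ≤ F y x' := fun y => by
    obtain ⟨x, hx, h1, h2⟩ := hK.exists_sInf_image_eq_and_le hne (hFcy y).continuousOn
    exact ⟨x, hx, h1, fun x' hx' => h1.trans_le (h2 x' hx')⟩
  have hball : ∀ x y : Fin N → ℝ, x ∈ closedBall (0 : Fin N → ℝ) R → x + y ∈ closedBall y R := by
    intro x y hx
    simpa [mem_closedBall, dist_eq_norm] using hx
  have hFu : ∀ y : Fin N → ℝ, h + R ≤ y i₀ → ∀ x ∈ closedBall (0 : Fin N → ℝ) R,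
      F y x = u (x + y) - (z + ε * (gauss a y (x + y) - κ)) := fun y hy x hx => by
    simp only [hF]
    rw [hUu _ (le_coord_of_mem_closedBall (hball x y hx) hy)]
  have hm0 : 0 < m y₀ := by
    obtain ⟨x, hx, h1, -⟩ := hatt y₀
    rw [h1, hFu y₀ hy₀ x hx]
    have h2 := hstart _ (hball x y₀ hx)
    have h3 := gauss_le_one ha.le y₀ (x + y₀)
    have : ε * (gauss a y₀ (x + y₀) - κ) ≤ ε * (1 - κ) := by gcongr
    nlinarith
  have hmne : ∀ y : Fin N → ℝ, h + R ≤ y i₀ → m y ≠ 0 := fun y hy h0 => by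
    obtain ⟨x, hx, h1, h2⟩ := hatt y
    refine no_touch y hy _ (hball x y hx) (fun x' hx' => ?_) ?_
    · have hx'' : x' - y ∈ closedBall (0 : Fin N → ℝ) R := by
        simpa [mem_closedBall, dist_eq_norm] using hx'
      have := h2 _ hx''
      rw [hFu y hy _ hx'', h0, sub_add_cancel] at this
      exact this
    · rw [← hFu y hy x hx, ← h1, h0]
  intro y hy
  have hpos : 0 < m y := by
    by_contra! hle
    have hconv : Convex ℝ {y : Fin N → ℝ | h + R ≤ y i₀} :=
      convex_halfSpace_ge (IsLinearMap.mk (fun _ _ => rfl) fun _ _ => rfl) _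
    obtain ⟨y', hy', h0⟩ := hconv.isPreconnected.intermediate_value hy hy₀ hmc.continuousOn
      ⟨hle, hm0.le⟩
    exact hmne y' hy' h0
  obtain ⟨x, hx, h1, h2⟩ := hatt y
  have hz : (0 : Fin N → ℝ) ∈ closedBall (0 : Fin N → ℝ) R := by simp [hR.le]
  have h3 := h2 0 hz
  rw [hFu y hy 0 hz, zero_add] at h3
  have h4 : gauss a y y = 1 := by simp [gauss]
  rw [h4] at h3
  nlinarith

theorem pos_of_exists_pos (hu : IsHalfSpaceSol f i₀ u)
    (hex : ∃ x : Fin N → ℝ, 0 < x i₀ ∧ 0 < u x) :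
    ∀ x : Fin N → ℝ, 0 < x i₀ → 0 < u x := by
  have hP : IsOpen {x : Fin N → ℝ | 0 < x i₀} :=
    isOpen_lt continuous_const (continuous_apply i₀)
  have hconv : Convex ℝ {x : Fin N → ℝ | 0 < x i₀} :=
    convex_halfSpace_gt (IsLinearMap.mk (fun _ _ => rfl) fun _ _ => rfl) _
  have hpos : IsOpen {x : Fin N → ℝ | 0 < x i₀ ∧ 0 < u x} :=
    hu.cont.isOpen_inter_preimage hP isOpen_Ioi
  have hzero : IsOpen {x : Fin N → ℝ | 0 < x i₀ ∧ u x = 0} := by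
    rw [Metric.isOpen_iff]
    rintro q ⟨hq, hq0⟩
    set ρ := q i₀ / 4 with hρ
    have hρ0 : 0 < ρ := by positivity
    refine ⟨ρ / (N + 1), by positivity, fun p hp => ?_⟩
    have hρN : ρ / (N + 1) ≤ ρ := div_le_self hρ0.le (by linarith [N.cast_nonneg (α := ℝ)])
    have hqp : q ∈ closedBall p (ρ / (N + 1)) := by
      rw [mem_closedBall, dist_comm]; exact (mem_ball.1 hp).le
    have hp3 : ρ + 2 * ρ ≤ p i₀ :=
      le_coord_of_mem_closedBall (closedBall_subset_closedBall hρN (ball_subset_closedBall hp))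
        (by linarith)
    have hp0 : 0 < p i₀ := by linarith
    refine ⟨hp0, ?_⟩
    by_contra hne
    have hup : 0 < u p := lt_of_le_of_ne (hu.nonneg p hp0) (Ne.symm hne)
    have hev : ∀ᶠ x in 𝓝 p, u p / 2 < u x :=
      (hu.cont.continuousAt (hP.mem_nhds hp0)).eventually (lt_mem_nhds (by linarith))
    obtain ⟨r, hr, hrp⟩ := Metric.eventually_nhds_iff_ball.1 hev
    have hq2 : q ∈ closedBall p (2 * ρ) :=
      closedBall_subset_closedBall (by linarith) hqp
    have hAr : (N : ℝ) < 2 * ((N + 1) / r ^ 2) * r ^ 2 := by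
      have : 2 * ((N + 1) / r ^ 2) * r ^ 2 = 2 * ((N : ℝ) + 1) := by field_simp
      rw [this]; linarith [N.cast_nonneg (α := ℝ)]
    have hA : (0 : ℝ) < (N + 1) / r ^ 2 := by positivity
    have key := hu.gauss_barrier_le (m := 0) (δ := u p / 2) hρ0 hp3 hr (by linarith) hA hAr
      (by linarith)
      (fun x hx => hu.nonneg x (hρ0.trans_le (le_coord_of_mem_closedBall hx hp3)))
      (fun x hx => by rw [zero_add]; exact (hrp x hx).le) hq2
    have hS := sum_sq_le_of_mem_closedBall hqp
    have hS2 : N * (ρ / (N + 1)) ^ 2 < (2 * ρ) ^ 2 := by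
      have h1 : (ρ / (N + 1)) * (N + 1) = ρ := by field_simp
      have h2 : 0 < ρ / (N + 1) := by positivity
      nlinarith [N.cast_nonneg (α := ℝ)]
    have hlt : Real.exp (-((N + 1) / r ^ 2) * (2 * ρ) ^ 2) < gauss ((N + 1) / r ^ 2) p q := by
      rw [gauss, Real.exp_lt_exp]
      have := mul_lt_mul_of_pos_left (hS.trans_lt hS2) hA
      linarith
    rw [hq0] at key
    nlinarith
  obtain ⟨x₁, hx₁, hx₁u⟩ := hex
  intro x hx
  refine (lt_of_le_of_ne (hu.nonneg x hx) fun h0 => ?_)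
  obtain ⟨y, -, ⟨-, hy⟩, -, hyz⟩ := hconv.isPreconnected _ _ hpos hzero
    (fun y hy => (hu.nonneg y hy).eq_or_lt.symm.imp (fun h => ⟨hy, h⟩) fun h => ⟨hy, h.symm⟩)
    ⟨x₁, hx₁, hx₁, hx₁u⟩ ⟨x, hx, hx, h0.symm⟩
  exact hy.ne' hyz

/-- The lower limit of `u` at infinity in the direction `i₀` is a zero of `f`. -/
theorem eq_zero_of_liminf (hu : IsHalfSpaceSol f i₀ u) {z : ℝ} (hz : 0 ≤ z)
    (hf : ContinuousWithinAt f (Ici 0) z)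
    (hlow : ∀ η > 0, ∃ h : ℝ, ∀ x : Fin N → ℝ, h ≤ x i₀ → z - η < u x)
    (hfreq : ∀ η > 0, ∀ h : ℝ, ∃ x : Fin N → ℝ, h ≤ x i₀ ∧ u x < z + η) : f z = 0 := by
  refine le_antisymm ?_ (hu.f_nonneg z hz)
  by_contra! hpos
  obtain ⟨δ, hδ, hfδ⟩ := Metric.continuousWithinAt_iff.1 hf (f z / 2) (by linarith)
  obtain ⟨ε, hε, hεδ, hεf⟩ : ∃ ε > 0, ε < δ ∧ 12 * N * ε ≤ f z / 2 := by
    refine ⟨min (δ / 2) (f z / (24 * (N + 1))), by positivity,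
      (min_le_left _ _).trans_lt (by linarith), ?_⟩
    calc 12 * N * min (δ / 2) (f z / (24 * (N + 1)))
        ≤ 12 * (N + 1) * (f z / (24 * (N + 1))) := by
          gcongr
          · linarith
          · exact min_le_right _ _
      _ = f z / 2 := by field_simp; norm_num
  obtain ⟨h, hh⟩ := hlow ε hε
  obtain ⟨p, hp, hup⟩ := hfreq ε hε (max h 1 + 1)
  have hmem : ∀ x ∈ closedBall p 1, h ≤ x i₀ ∧ 1 ≤ x i₀ := fun x hx =>
    max_le_iff.1 (le_coord_of_mem_closedBall hx hp)
  have hcont : ContinuousOn (fun x => u x + 3 * ε * ∑ k, (x k - p k) ^ 2) (closedBall p 1) := by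
    refine ContinuousOn.add (hu.continuousOn_closedBall (h := max h 1) (by positivity) hp) ?_
    fun_prop
  have hp1 : p ∈ closedBall p 1 := by simp
  obtain ⟨y, hyR, hy⟩ := (isCompact_closedBall p 1).exists_isMinOn ⟨p, hp1⟩ hcont
  have hyp : u y + 3 * ε * ∑ k, (y k - p k) ^ 2 ≤ u p + 3 * ε * ∑ k, (p k - p k) ^ 2 := hy hp1
  have h0 : ∑ k, (p k - p k) ^ 2 = 0 := by simp
  rw [h0, mul_zero, add_zero] at hyp
  have hylow := hh y (hmem y hyR).1
  have hy0 : 0 < y i₀ := zero_lt_one.trans_le (hmem y hyR).2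
  have hS : 0 ≤ ∑ k, (y k - p k) ^ 2 := Finset.sum_nonneg fun k _ => sq_nonneg _
  have hyb : y ∈ ball p 1 := by
    by_contra hyb
    have := exists_sq_le_of_notMem_ball one_pos hyb
    nlinarith
  have hloc : IsLocalMin (fun x => u x + 3 * ε * ∑ k, (x k - p k) ^ 2) y :=
    hy.isLocalMin (mem_of_superset (isOpen_ball.mem_nhds hyb) ball_subset_closedBall)
  have hlap := ((hu.hasLap y hy0).add ((hasLap_sum_sq p y).const_mul (3 * ε))).nonneg_of_isLocalMin
    hloc
  have hdist : dist (u y) z < δ := by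
    rw [Real.dist_eq, abs_lt]
    have : 0 ≤ 3 * ε * ∑ k, (y k - p k) ^ 2 := by positivity
    constructor <;> linarith
  have hfy := hfδ (hu.nonneg y hy0) hdist
  rw [Real.dist_eq, abs_lt] at hfy
  have hNε : 0 ≤ N * ε := by positivity
  linarith

/-- The lower limit of a positive solution at infinity in the direction `i₀` is positive. -/
theorem liminf_ne_zero (hu : IsHalfSpaceSol f i₀ u)
    (hpos : ∀ x : Fin N → ℝ, 0 < x i₀ → 0 < u x) {c s₀ : ℝ} (hc : 0 < c) (hs₀ : 0 < s₀)
    (hf : ∀ s, 0 < s → s ≤ s₀ → c * s ≤ f s)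
    (hfreq : ∀ η > 0, ∀ h : ℝ, ∃ x : Fin N → ℝ, h ≤ x i₀ ∧ u x < η) : False := by
  obtain ⟨κ, R, hκ, -, hR, key⟩ := hu.spreading (z := 0) (s₀ := s₀) hc (by simpa using hf)
  set y₀ : Fin N → ℝ := fun _ => 1 + R with hy₀
  have hy₀i : 1 + R ≤ y₀ i₀ := le_rfl
  obtain ⟨q, hq, hqmin⟩ := (isCompact_closedBall y₀ R).exists_isMinOn ⟨y₀, by simp [hR.le]⟩
    (hu.continuousOn_closedBall one_pos hy₀i)
  have hq0 : 0 < u q := hpos q (one_pos.trans_le (le_coord_of_mem_closedBall hq hy₀i))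
  have hε : 0 < min (u q) s₀ := lt_min hq0 hs₀
  have hall := key (min (u q) s₀) 1 hε (min_le_right _ _) one_pos
    (fun x hx => by
      have := hpos x (one_pos.trans_le hx)
      have : 0 < min (u q) s₀ * κ / 2 := by positivity
      linarith)
    ⟨y₀, hy₀i, fun x hx => by
      rw [zero_add]
      exact (min_le_left _ _).trans (hqmin hx)⟩
  obtain ⟨x, hx, hxu⟩ := hfreq (min (u q) s₀ / 2) (by linarith) (1 + R)
  have := hall x hx
  linarith

/-- A uniformly continuous solution converges to its lower limit at infinity. -/
theorem le_of_liminf (hu : IsHalfSpaceSol f i₀ u) {z c s₀ G : ℝ} (hc : 0 < c) (hs₀ : 0 < s₀)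
    (hf : ∀ s, z < s → s ≤ z + s₀ → c * (s - z) ≤ f s)
    (hG : 0 < G)
    (hlip : ∀ x y : Fin N → ℝ, 2 ≤ x i₀ → 2 ≤ y i₀ → |u x - u y| ≤ G * ‖x - y‖)
    (hlow : ∀ η > 0, ∃ h : ℝ, ∀ x : Fin N → ℝ, h ≤ x i₀ → z - η < u x)
    (hfreq : ∀ η > 0, ∀ h : ℝ, ∃ x : Fin N → ℝ, h ≤ x i₀ ∧ u x < z + η) :
    ∀ η > 0, ∃ h : ℝ, ∀ x : Fin N → ℝ, h ≤ x i₀ → u x < z + η := by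
  intro η hη
  by_contra! hcon
  obtain ⟨κ, R, hκ, hκ2, hR, key⟩ := hu.spreading hc hf
  set δ := η / 2 with hδ
  have hδ0 : 0 < δ := by positivity
  set r := δ / G with hr
  have hr0 : 0 < r := by positivity
  set R' := (N + 1) * R + r with hR'
  have hR'0 : 0 < R' := by positivity
  have hRR' : R ≤ R' := by nlinarith [N.cast_nonneg (α := ℝ)]
  have hrR' : r ≤ R' := by
    have : 0 ≤ (N + 1) * R := by positivity
    linarith
  set A := (N + 1) / r ^ 2 with hA
  have hA0 : 0 < A := by positivity
  have hAr : (N : ℝ) < 2 * A * r ^ 2 := by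
    have : 2 * A * r ^ 2 = 2 * ((N : ℝ) + 1) := by rw [hA]; field_simp
    rw [this]; linarith [N.cast_nonneg (α := ℝ)]
  set ε' := δ * (Real.exp (-A * (N * R ^ 2)) - Real.exp (-A * R' ^ 2)) with hε'
  have hε'0 : 0 < ε' := by
    refine mul_pos hδ0 (sub_pos.2 (Real.exp_lt_exp.2 ?_))
    have h1 : (N : ℝ) * R ^ 2 < R' ^ 2 := by
      have h2 : ((N + 1) * R) ^ 2 ≤ R' ^ 2 := by
        have : (N + 1) * R ≤ R' := by linarith
        gcongr
      have h3 : 0 < R ^ 2 := by positivity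
      nlinarith [N.cast_nonneg (α := ℝ)]
    have := mul_lt_mul_of_pos_left h1 hA0
    linarith
  set ε := min s₀ (ε' / 2) with hε
  have hε0 : 0 < ε := lt_min hs₀ (by linarith)
  have hε2 : ε ≤ ε' / 2 := min_le_right _ _
  have hεκ : 0 < ε * κ / 2 := by positivity
  have hεκ2 : ε * κ / 2 ≤ ε := by nlinarith
  obtain ⟨h₀, hh₀⟩ := hlow (ε * κ / 2) hεκ
  set h := max h₀ 2 with hh
  have hh2 : 2 ≤ h := le_max_right _ _
  have hhlow : ∀ x : Fin N → ℝ, h ≤ x i₀ → z - ε * κ / 2 < u x := fun x hx =>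
    hh₀ x ((le_max_left _ _).trans hx)
  obtain ⟨p, hp, hpu⟩ := hcon (h + R')
  have hstart : ∀ x ∈ closedBall p R, z + ε ≤ u x := by
    intro x hx
    have hb := hu.gauss_barrier_le (m := z - ε * κ / 2) (δ := δ) (by linarith) hp hr0 hR'0 hA0
      hAr hδ0 (fun x hx => (hhlow x (le_coord_of_mem_closedBall hx hp)).le)
      (fun x hx => by
        have hxi : h ≤ x i₀ := le_coord_of_mem_closedBall
          (closedBall_subset_closedBall hrR' (ball_subset_closedBall hx)) hp
        have h1 := hlip x p (hh2.trans hxi) (by linarith)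
        have h2 : G * ‖x - p‖ ≤ δ := by
          rw [mem_ball, dist_eq_norm] at hx
          calc G * ‖x - p‖ ≤ G * r := by gcongr
            _ = δ := by rw [hr]; field_simp
        have h3 := (abs_le.1 h1).1
        linarith)
      (closedBall_subset_closedBall hRR' hx)
    have hg : Real.exp (-A * (N * R ^ 2)) ≤ gauss A p x := by
      rw [gauss, Real.exp_le_exp]
      have := mul_le_mul_of_nonneg_left (sum_sq_le_of_mem_closedBall hx) hA0.le
      linarith
    have : ε' ≤ δ * (gauss A p x - Real.exp (-A * R' ^ 2)) := by rw [hε']; gcongr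
    linarith
  have hall := key ε h hε0 (min_le_left _ _) (by linarith) hhlow
    ⟨p, by linarith, hstart⟩
  obtain ⟨x, hx, hxu⟩ := hfreq (ε / 2) (by linarith) (h + R)
  have := hall x hx
  linarith

end IsHalfSpaceSol

section PartialDerivatives

variable {N : ℕ} {u : (Fin N → ℝ) → ℝ} {U : Set (Fin N → ℝ)} {x : Fin N → ℝ}

theorem hasDerivAt_pd (hu : DifferentiableAt ℝ u x) (i : Fin N) :
    HasDerivAt (fun t => u (Function.update x i t)) (fderiv ℝ u x (Pi.single i 1)) (x i) := by
  have h : HasFDerivAt u (fderiv ℝ u x) (Function.update x i (x i)) := by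
    simpa using hu.hasFDerivAt
  exact h.comp_hasDerivAt (x i) (hasDerivAt_update x i (x i))

theorem pd_eq_fderiv (hu : DifferentiableAt ℝ u x) (i : Fin N) :
    pd i u x = fderiv ℝ u x (Pi.single i 1) :=
  (hasDerivAt_pd hu i).deriv

theorem differentiableAt_pd (hU : IsOpen U) (hu : ContDiffOn ℝ 2 u U) (hx : x ∈ U) (i : Fin N) :
    DifferentiableAt ℝ (pd i u) x := by
  have h1 : DifferentiableAt ℝ (fderiv ℝ u) x :=
    ((hu.contDiffAt (hU.mem_nhds hx)).fderiv_right (m := 1) (by norm_num)).differentiableAt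
      (by norm_num)
  refine (h1.clm_apply (differentiableAt_const (Pi.single i 1))).congr_of_eventuallyEq ?_
  filter_upwards [hU.mem_nhds hx] with y hy
  exact pd_eq_fderiv ((hu.contDiffAt (hU.mem_nhds hy)).differentiableAt (by norm_num)) i

theorem hasLap_lap (hU : IsOpen U) (hu : ContDiffOn ℝ 2 u U) (hx : x ∈ U) :
    HasLap u (lap u x) x := by
  refine ⟨fun j => pd j (pd j u) x, fun j =>
    ⟨fun t => pd j u (Function.update x j t), ?_, ?_⟩, rfl⟩
  · have hc : Tendsto (Function.update x j) (𝓝 (x j)) (𝓝 x) := by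
      simpa using (hasDerivAt_update x j (x j)).continuousAt.tendsto
    filter_upwards [hc.eventually (hU.mem_nhds hx)] with s hs
    have hd := (hu.contDiffAt (hU.mem_nhds hs)).differentiableAt (by norm_num)
    have := hasDerivAt_pd hd j
    rw [← pd_eq_fderiv hd] at this
    simpa using this
  · have hd := differentiableAt_pd hU hu hx j
    have := hasDerivAt_pd hd j
    rwa [← pd_eq_fderiv hd] at this

theorem norm_fderiv_le_of_pd_le {G : ℝ} (hG : 0 ≤ G) (hu : DifferentiableAt ℝ u x)
    (h : ∀ i, |pd i u x| ≤ G) : ‖fderiv ℝ u x‖ ≤ N * G := by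
  refine ContinuousLinearMap.opNorm_le_bound _ (by positivity) fun v => ?_
  have hv : fderiv ℝ u x v = ∑ i, v i * pd i u x := by
    conv_lhs => rw [pi_eq_sum_univ' v, map_sum]
    exact Finset.sum_congr rfl fun i _ => by
      rw [map_smul, pd_eq_fderiv hu, smul_eq_mul]
  rw [hv]
  calc ‖∑ i, v i * pd i u x‖ ≤ ∑ i, ‖v i * pd i u x‖ := norm_sum_le _ _
    _ ≤ ∑ _i : Fin N, ‖v‖ * G := by
      refine Finset.sum_le_sum fun i _ => ?_
      rw [norm_mul]
      gcongr
      · exact norm_le_pi_norm v i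
      · exact h i
    _ = N * G * ‖v‖ := by simp; ring

theorem abs_sub_le_of_pd_le {G : ℝ} (hG : 0 ≤ G) (hconv : Convex ℝ U)
    (hu : ∀ x ∈ U, DifferentiableAt ℝ u x) (h : ∀ x ∈ U, ∀ i, |pd i u x| ≤ G)
    {y : Fin N → ℝ} (hx : x ∈ U) (hy : y ∈ U) : |u x - u y| ≤ N * G * ‖x - y‖ :=
  hconv.norm_image_sub_le_of_norm_fderiv_le hu
    (fun z hz => norm_fderiv_le_of_pd_le hG (hu z hz) (h z hz)) hy hx

end PartialDerivatives

namespace IsHalfSpaceSol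

variable {N : ℕ} {f : ℝ → ℝ} {i₀ : Fin N} {u : (Fin N → ℝ) → ℝ}

theorem differentiableAt_of_contDiffOn (hu2 : ContDiffOn ℝ 2 u {x : Fin N → ℝ | 0 < x i₀})
    {x : Fin N → ℝ} (hx : 0 < x i₀) : DifferentiableAt ℝ u x :=
  (hu2.contDiffAt ((isOpen_lt continuous_const (continuous_apply i₀)).mem_nhds hx)).differentiableAt
    (by norm_num)

/-- First order interior estimate. -/
theorem abs_pd_le (hu : IsHalfSpaceSol f i₀ u)
    (hu2 : ContDiffOn ℝ 2 u {x : Fin N → ℝ | 0 < x i₀}) {h z M K : ℝ} (hh : 0 < h)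
    (hM : ∀ x : Fin N → ℝ, h ≤ x i₀ → |u x - z| ≤ M)
    (hK : ∀ x : Fin N → ℝ, h ≤ x i₀ → |f (u x)| < K)
    {x : Fin N → ℝ} (hx : h + 1 ≤ x i₀) (i : Fin N) : |pd i u x| ≤ N * M + K / 2 := by
  have hmem : ∀ y ∈ closedBall x 1, h ≤ y i₀ := fun y hy => le_coord_of_mem_closedBall hy hx
  have hd := differentiableAt_of_contDiffOn hu2 (show 0 < x i₀ by linarith)
  have := abs_deriv_le_of_hasLap (w := fun y => u y - z) (lw := fun y => -f (u y)) one_pos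
    ((hu.continuousOn_closedBall hh hx).sub continuousOn_const)
    (fun y hy => by
      simpa using (hu.hasLap y (hh.trans_le (hmem y hy))).sub (HasLap.const z y))
    (fun y hy => by simpa using hK y (hmem y hy)) (fun y hy => hM y (hmem y hy)) i
    ((hasDerivAt_pd hd i).sub_const z)
  rw [pd_eq_fderiv hd]
  simpa using this

/-- Second order interior estimate, from the first order estimate applied to difference
quotients. -/
theorem abs_pd_pd_le (hu : IsHalfSpaceSol f i₀ u)
    (hu2 : ContDiffOn ℝ 2 u {x : Fin N → ℝ | 0 < x i₀}) {h C G : ℝ} {L : NNReal} (hh : 0 < h)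
    (hC : ∀ x : Fin N → ℝ, h ≤ x i₀ → u x ≤ C) (hL : LipschitzOnWith L f (Icc 0 C))
    (hG : 0 < G) (hpd : ∀ x : Fin N → ℝ, h ≤ x i₀ → ∀ i, |pd i u x| ≤ G)
    {x : Fin N → ℝ} (hx : h + 2 ≤ x i₀) (i j : Fin N) :
    |pd i (pd j u) x| ≤ (N * (N * G) + (L * (N * G) + G) / 2) := by
  have hdiff : ∀ y : Fin N → ℝ, h ≤ y i₀ → DifferentiableAt ℝ u y := fun y hy =>
    differentiableAt_of_contDiffOn hu2 (hh.trans_le hy)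
  have hconv : Convex ℝ {y : Fin N → ℝ | h ≤ y i₀} :=
    convex_halfSpace_ge (IsLinearMap.mk (fun _ _ => rfl) fun _ _ => rfl) _
  have hlip : ∀ y y' : Fin N → ℝ, h ≤ y i₀ → h ≤ y' i₀ → |u y - u y'| ≤ N * G * ‖y - y'‖ :=
    fun y y' hy hy' => abs_sub_le_of_pd_le hG.le hconv hdiff hpd hy hy'
  have hx0 : 0 < x i₀ := by linarith
  have hdpd : DifferentiableAt ℝ (pd j u) x :=
    differentiableAt_pd (isOpen_lt continuous_const (continuous_apply i₀)) hu2 hx0 j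
  rw [pd_eq_fderiv hdpd]
  refine (hasDerivAt_pd hdpd i).le_of_lip' (by positivity) ?_
  filter_upwards [ball_mem_nhds (x i) one_pos] with t ht
  rw [Function.update_eq_self, Real.norm_eq_abs, Real.norm_eq_abs]
  rcases eq_or_ne t (x i) with rfl | hne
  · simp
  set s := t - x i with hs
  have hs0 : 0 < |s| := abs_pos.2 (sub_ne_zero.2 hne)
  have hs1 : |s| < 1 := ht
  set e : Fin N → ℝ := Pi.single i s with he
  have hen : ‖e‖ = |s| := by rw [he, Pi.norm_single, Real.norm_eq_abs]
  have hei : |e i₀| ≤ |s| := by rw [← hen]; exact norm_le_pi_norm e i₀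
  have hxe : Function.update x i t = x + e := by
    ext k
    rcases eq_or_ne k i with rfl | hk
    · simp [he, hs]
    · simp [he, hk]
  have hmem : ∀ y ∈ closedBall x 1, h ≤ y i₀ ∧ h ≤ (y + e) i₀ := fun y hy => by
    have h1 : h + 1 ≤ y i₀ := le_coord_of_mem_closedBall hy (by linarith)
    have h2 := (abs_le.1 hei).1
    refine ⟨by linarith, ?_⟩
    rw [Pi.add_apply]; linarith
  have hve : ∀ y ∈ closedBall x 1, |u (y + e) - u y| ≤ N * G * |s| := fun y hy => by
    have := hlip _ _ (hmem y hy).2 (hmem y hy).1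
    rwa [add_sub_cancel_left, hen] at this
  have hxm := hmem x (by simp)
  have hderiv : HasDerivAt (fun r => u (Function.update x j r + e) - u (Function.update x j r))
      (pd j u (x + e) - pd j u x) (x j) := by
    rw [pd_eq_fderiv (hdiff _ hxm.1), pd_eq_fderiv (hdiff _ hxm.2)]
    refine HasDerivAt.sub ?_ (hasDerivAt_pd (hdiff _ hxm.1) j)
    have h1 : HasFDerivAt u (fderiv ℝ u (x + e)) (Function.update x j (x j) + e) := by
      simpa using (hdiff _ hxm.2).hasFDerivAt
    exact h1.comp_hasDerivAt (x j) ((hasDerivAt_update x j (x j)).add_const e)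
  have hcont : ContinuousOn (fun y => u (y + e) - u y) (closedBall x 1) := by
    refine ContinuousOn.sub ?_ (hu.continuousOn_closedBall hh (by linarith))
    exact hu.cont.comp (by fun_prop) fun y hy => hh.trans_le (hmem y hy).2
  have hUmem : ∀ y : Fin N → ℝ, h ≤ y i₀ → u y ∈ Icc 0 C := fun y hy =>
    ⟨hu.nonneg y (hh.trans_le hy), hC y hy⟩
  have key := abs_deriv_le_of_hasLap (w := fun y => u (y + e) - u y)
    (lw := fun y => -f (u (y + e)) - -f (u y)) (M := N * G * |s|)
    (K := (L * (N * G) + G) * |s|) one_pos hcont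
    (fun y hy => (hu.hasLap _ (hh.trans_le (hmem y hy).2)).comp_add_const.sub
      (hu.hasLap y (hh.trans_le (hmem y hy).1)))
    (fun y hy => by
      have h1 := hL.dist_le_mul _ (hUmem _ (hmem y hy).1) _ (hUmem _ (hmem y hy).2)
      rw [Real.dist_eq, Real.dist_eq, abs_sub_comm (u y)] at h1
      have h2 : (L : ℝ) * |u (y + e) - u y| ≤ L * (N * G * |s|) := by
        have := hve y hy
        gcongr
      have h3 : 0 < G * |s| := mul_pos hG hs0
      rw [show -f (u (y + e)) - -f (u y) = f (u y) - f (u (y + e)) by ring]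
      linarith)
    hve j hderiv
  rw [hxe]
  convert key using 1
  ring

end IsHalfSpaceSol

theorem tendstoUniformlyOn_translates {N : ℕ} {i₀ : Fin N} {g : (Fin N → ℝ) → ℝ} {l : ℝ}
    (hg : ∀ η > 0, ∃ h : ℝ, ∀ x : Fin N → ℝ, h ≤ x i₀ → |g x - l| < η) (A : ℝ) :
    TendstoUniformlyOn (fun (h : ℝ) x => g (Function.update x i₀ (x i₀ + h))) (fun _ => l)
      atTop {x : Fin N → ℝ | A ≤ x i₀} := by
  rw [Metric.tendstoUniformlyOn_iff]
  intro η hη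
  obtain ⟨H, hH⟩ := hg η hη
  filter_upwards [eventually_ge_atTop (H - A)] with h hh x hx
  rw [dist_comm, Real.dist_eq]
  refine hH _ ?_
  have hx' : A ≤ x i₀ := hx
  rw [Function.update_self]
  linarith

/-- The lower limit at infinity in the direction `i₀` of a bounded function. -/
theorem exists_liminf {N : ℕ} {i₀ : Fin N} {u : (Fin N → ℝ) → ℝ} {C : ℝ}
    (hu : ∀ x : Fin N → ℝ, 0 < x i₀ → 0 ≤ u x) (hC : ∀ x : Fin N → ℝ, 0 < x i₀ → u x ≤ C) :
    ∃ z, 0 ≤ z ∧ z ≤ C ∧ (∀ η > 0, ∃ h : ℝ, ∀ x : Fin N → ℝ, h ≤ x i₀ → z - η < u x) ∧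
      ∀ η > 0, ∀ h : ℝ, ∃ x : Fin N → ℝ, h ≤ x i₀ ∧ u x < z + η := by
  set S : Set ℝ := {m | ∃ h : ℝ, ∀ x : Fin N → ℝ, h ≤ x i₀ → m ≤ u x} with hS
  have h0 : (0 : ℝ) ∈ S := ⟨1, fun x hx => hu x (one_pos.trans_le hx)⟩
  have hb : ∀ m ∈ S, m ≤ C := by
    rintro m ⟨h, hm⟩
    have h1 := hm (fun _ => max h 1) (le_max_left _ _)
    exact h1.trans (hC _ (one_pos.trans_le (le_max_right _ _)))
  have hbdd : BddAbove S := ⟨C, hb⟩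
  refine ⟨sSup S, le_csSup hbdd h0, csSup_le ⟨0, h0⟩ hb, fun η hη => ?_, fun η hη h => ?_⟩
  · obtain ⟨m, ⟨h, hm⟩, hlt⟩ := exists_lt_of_lt_csSup ⟨0, h0⟩ (sub_lt_self (sSup S) hη)
    exact ⟨h, fun x hx => hlt.trans_le (hm x hx)⟩
  · by_contra! hcon
    have := le_csSup hbdd (show sSup S + η ∈ S from ⟨h, hcon⟩)
    linarith

/-- A zero of `f` satisfying the right lower-slope condition of `H2` is linearly unstable from
the right. -/
theorem exists_linear_lower_bound {f : ℝ → ℝ} {z : ℝ}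
    (h : ∃ c > 0, ∀ᶠ s in 𝓝[>] z, c ≤ f s / (s - z)) :
    ∃ c > 0, ∃ s₀ > 0, ∀ s, z < s → s ≤ z + s₀ → c * (s - z) ≤ f s := by
  obtain ⟨c, hc, hev⟩ := h
  obtain ⟨b, hb, hsub⟩ := (mem_nhdsGT_iff_exists_Ioc_subset).1 hev
  refine ⟨c, hc, b - z, sub_pos.2 hb, fun s hs hsb => ?_⟩
  have : c ≤ f s / (s - z) := hsub ⟨hs, by linarith⟩
  rwa [le_div_iff₀ (sub_pos.2 hs)] at this

/-- Theorem 1.3: under (H2), any nontrivial bounded nonnegative solution of the half-space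
problem converges in `C²`, uniformly on `[A,+∞) × ℝ^{N-1}`, to a constant `z` which is a
nonzero zero of `f`. -/
theorem stmt_3
    (f : ℝ → ℝ) (hf : H2 f)
    {N : ℕ} (hN : 2 ≤ N) (i0 : Fin N) (hi0 : (i0 : ℕ) = 0)
    (u u₀ : (Fin N → ℝ) → ℝ)
    (hu_smooth : ContDiffOn ℝ 2 u {x : Fin N → ℝ | 0 < x i0})
    (hu_cont : ContinuousOn u {x : Fin N → ℝ | 0 ≤ x i0})
    (hu_nonneg : ∀ x : Fin N → ℝ, 0 ≤ x i0 → 0 ≤ u x)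
    (hu_bdd : ∃ C, ∀ x : Fin N → ℝ, 0 ≤ x i0 → u x ≤ C)
    (hu_pde : ∀ x : Fin N → ℝ, 0 < x i0 → lap u x + f (u x) = 0)
    (hu_init : ∀ x : Fin N → ℝ, x i0 = 0 → u x = u₀ x)
    (hu₀_cont : ContinuousOn u₀ {x : Fin N → ℝ | x i0 = 0})
    (hu₀_bdd : ∃ C, ∀ x : Fin N → ℝ, x i0 = 0 → u₀ x ≤ C)
    (hu₀_nonneg : ∀ x : Fin N → ℝ, x i0 = 0 → 0 ≤ u₀ x)
    (hu₀_ne : ∃ x : Fin N → ℝ, x i0 = 0 ∧ u₀ x ≠ 0) :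
    ∃ z : ℝ, 0 < z ∧ f z = 0 ∧
      ∀ A : ℝ,
        C2ConvOn i0 u {x : Fin N → ℝ | A ≤ x i0}
          (fun _ => z) (fun _ _ => 0) (fun _ _ _ => 0) := by
  obtain ⟨C, hC⟩ := hu_bdd
  obtain ⟨L, hL⟩ := hf.1 C
  have hopen : IsOpen {x : Fin N → ℝ | 0 < x i0} :=
    isOpen_lt continuous_const (continuous_apply i0)
  have hsol : IsHalfSpaceSol f i0 u :=
    { f_nonneg := hf.2.1
      cont := hu_smooth.continuousOn
      hasLap := fun x hx => by
        rw [← eq_neg_of_add_eq_zero_left (hu_pde x hx)]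
        exact hasLap_lap hopen hu_smooth hx
      nonneg := fun x hx => hu_nonneg x hx.le }
  have hdiff : ∀ x : Fin N → ℝ, 0 < x i0 → DifferentiableAt ℝ u x := fun x hx =>
    IsHalfSpaceSol.differentiableAt_of_contDiffOn hu_smooth hx
  obtain ⟨z, hz0, hzC, hlow, hfreq⟩ :=
    exists_liminf hsol.nonneg (fun x hx => hC x hx.le)
  have hmem : ∀ x : Fin N → ℝ, 0 < x i0 → u x ∈ Icc 0 C := fun x hx =>
    ⟨hsol.nonneg x hx, hC x hx.le⟩
  have hfL : ∀ x : Fin N → ℝ, 0 < x i0 → |f (u x) - f z| ≤ L * |u x - z| := fun x hx =>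
    hL.dist_le_mul _ (hmem x hx) _ ⟨hz0, hzC⟩
  have hfcont : ContinuousWithinAt f (Ici 0) z := by
    obtain ⟨L', hL'⟩ := hf.1 (z + 1)
    refine (hL'.continuousOn.continuousWithinAt ⟨hz0, by linarith⟩).mono_of_mem_nhdsWithin ?_
    refine mem_of_superset (inter_mem_nhdsWithin _ (Iio_mem_nhds (lt_add_one z))) ?_
    exact fun s hs => ⟨hs.1, le_of_lt hs.2⟩
  have hfz : f z = 0 := hsol.eq_zero_of_liminf hz0 hfcont hlow hfreq
  obtain ⟨c, hc, s₀, hs₀, hlin⟩ := exists_linear_lower_bound (hf.2.2 z hz0 hfz)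
  have hzpos : 0 < z := by
    refine lt_of_le_of_ne hz0 fun h0 => ?_
    obtain ⟨x₀, hx₀, hx₀u⟩ := hu₀_ne
    have hux₀ : 0 < u x₀ := by
      refine lt_of_le_of_ne (hu_nonneg x₀ hx₀.ge) fun h => hx₀u ?_
      rw [← hu_init x₀ hx₀, ← h]
    have hex : ∃ x : Fin N → ℝ, 0 < x i0 ∧ 0 < u x := by
      have hev : ∀ᶠ x in 𝓝[{x | 0 ≤ x i0}] x₀, 0 < u x :=
        (hu_cont x₀ hx₀.ge).eventually (lt_mem_nhds hux₀)
      have hcu : Continuous (Function.update x₀ i0) :=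
        continuous_const.update i0 continuous_id
      have htend : Tendsto (Function.update x₀ i0) (𝓝[>] 0) (𝓝[{x | 0 ≤ x i0}] x₀) := by
        refine tendsto_nhdsWithin_iff.2 ⟨?_, ?_⟩
        · have := hcu.tendsto 0
          rw [← hx₀, Function.update_eq_self] at this
          rw [← hx₀]
          exact this.mono_left nhdsWithin_le_nhds
        · filter_upwards [self_mem_nhdsWithin] with t ht
          have ht' : 0 < t := ht
          simpa using ht'.le
      obtain ⟨t, ht, ht0⟩ := ((htend.eventually hev).and self_mem_nhdsWithin).exists
      exact ⟨_, by simpa using ht0, ht⟩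
    subst h0
    exact hsol.liminf_ne_zero (hsol.pos_of_exists_pos hex) hc hs₀ (by simpa using hlin)
      (by simpa using hfreq)
  have hC0 : 0 ≤ C := hz0.trans hzC
  have hlip : ∃ G > 0, ∀ x y : Fin N → ℝ, 2 ≤ x i0 → 2 ≤ y i0 → |u x - u y| ≤ G * ‖x - y‖ := by
    set G₀ : ℝ := N * C + (L * C + 1) / 2 with hG₀
    have hG₀0 : 0 < G₀ := by positivity
    have hpd : ∀ x ∈ {x : Fin N → ℝ | 2 ≤ x i0}, ∀ i, |pd i u x| ≤ G₀ := by
      intro x hx i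
      have hx2 : (1 : ℝ) + 1 ≤ x i0 := by
        have : 2 ≤ x i0 := hx
        linarith
      have hMu : ∀ x : Fin N → ℝ, 1 ≤ x i0 → |u x - z| ≤ C := fun x hx => by
        have := hmem x (one_pos.trans_le hx)
        exact abs_sub_le_of_nonneg_of_le this.1 this.2 hz0 hzC
      refine hsol.abs_pd_le hu_smooth one_pos hMu (fun x hx => ?_) hx2 i
      have h1 := hfL x (one_pos.trans_le hx)
      have h2 : (L : ℝ) * |u x - z| ≤ L * C := by
        have := hMu x hx
        gcongr
      rw [hfz, sub_zero] at h1
      linarith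
    have hconv : Convex ℝ {x : Fin N → ℝ | 2 ≤ x i0} :=
      convex_halfSpace_ge (IsLinearMap.mk (fun _ _ => rfl) fun _ _ => rfl) _
    have hN0 : (0 : ℝ) < N := by exact_mod_cast (by omega : 0 < N)
    exact ⟨N * G₀, by positivity, fun x y hx hy => abs_sub_le_of_pd_le hG₀0.le hconv
      (fun x hx => hdiff x (two_pos.trans_le hx)) hpd hx hy⟩
  obtain ⟨G, hG, hlip⟩ := hlip
  have hup := hsol.le_of_liminf hc hs₀ hlin hG hlip hlow hfreq
  have hu_lim : ∀ η > 0, ∃ h : ℝ, ∀ x : Fin N → ℝ, h ≤ x i0 → |u x - z| < η := by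
    intro η hη
    obtain ⟨h₁, hh₁⟩ := hlow η hη
    obtain ⟨h₂, hh₂⟩ := hup η hη
    refine ⟨max h₁ h₂, fun x hx => abs_lt.2 ⟨?_, ?_⟩⟩
    · linarith [hh₁ x ((le_max_left _ _).trans hx)]
    · linarith [hh₂ x ((le_max_right _ _).trans hx)]
  have hpd_lim : ∀ η > 0, ∃ h : ℝ, ∀ x : Fin N → ℝ, h ≤ x i0 → ∀ i, |pd i u x| < η := by
    intro η hη
    set M : ℝ := η / (2 * (N + L + 1)) with hM
    have hM0 : 0 < M := by positivity
    obtain ⟨h, hh⟩ := hu_lim M hM0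
    have hpos : ∀ x : Fin N → ℝ, max h 1 ≤ x i0 → 0 < x i0 := fun x hx =>
      one_pos.trans_le ((le_max_right _ _).trans hx)
    have hMu : ∀ x : Fin N → ℝ, max h 1 ≤ x i0 → |u x - z| < M := fun x hx =>
      hh x ((le_max_left _ _).trans hx)
    refine ⟨max h 1 + 1, fun x hx i => ?_⟩
    have h1 := hsol.abs_pd_le hu_smooth (h := max h 1) (M := M) (K := (L + 1) * M) (by positivity)
      (fun x hx => (hMu x hx).le)
      (fun x hx => by
        have h1 := hfL x (hpos x hx)
        have h2 : (L : ℝ) * |u x - z| ≤ L * M := by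
          have := (hMu x hx).le
          gcongr
        rw [hfz, sub_zero] at h1
        linarith) hx i
    have h2 : M * (2 * (N + L + 1)) = η := by rw [hM]; field_simp
    have h3 : 0 ≤ L * M := by positivity
    have h4 : 0 ≤ N * M := by positivity
    linarith
  have hpd2_lim : ∀ η > 0, ∃ h : ℝ, ∀ x : Fin N → ℝ, h ≤ x i0 →
      ∀ i j, |pd i (pd j u) x| < η := by
    intro η hη
    set G : ℝ := η / (2 * (N * N + L * N + 1)) with hG
    have hG0 : 0 < G := by positivity
    obtain ⟨h, hh⟩ := hpd_lim G hG0
    refine ⟨max h 1 + 2, fun x hx i j => ?_⟩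
    have h1 := hsol.abs_pd_pd_le hu_smooth (h := max h 1) (by positivity)
      (fun x hx => hC x (zero_le_one.trans ((le_max_right _ _).trans hx))) hL hG0
      (fun x hx i => (hh x ((le_max_left _ _).trans hx) i).le) hx i j
    have h2 : G * (2 * (N * N + L * N + 1)) = η := by rw [hG]; field_simp
    have h3 : 0 ≤ L * (N * G) := by positivity
    have h4 : 0 ≤ N * (N * G) := by positivity
    linarith
  refine ⟨z, hzpos, hfz, fun A => ⟨tendstoUniformlyOn_translates hu_lim A, fun i => ?_,
    fun i j => ?_⟩⟩
  · refine tendstoUniformlyOn_translates (fun η hη => ?_) A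
    obtain ⟨h, hh⟩ := hpd_lim η hη
    exact ⟨h, fun x hx => by rw [sub_zero]; exact hh x hx i⟩
  · refine tendstoUniformlyOn_translates (fun η hη => ?_) A
    obtain ⟨h, hh⟩ := hpd2_lim η hη
    exact ⟨h, fun x hx => by rw [sub_zero]; exact hh x hx i j⟩
end
end
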